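/- arXiv:1809.03223 — 2 statements merged into one kernel-verified Lean document; each statement's English description precedes it below -/
import Mathlib

section
/- Assume χ(α_i, δ̂) = 1 for all i ∈ I, where δ̂ := α_0 + Σ_{t=1}^{N−1} α_t ∈ ⊕_{i∈I} ℤα_i. Let z_i, u_i ∈ K^× (i ∈ I) and x_{ij} := χ(α_i,α_j). Then there exists a K-algebra homomorphism Ψ : U^♮_χ → End_K(K^N ⊗_K K[t,t^{−1}]) such that: Ψ(K_∂)(e_k ⊗ t^m) = q^m e_k ⊗ t^m and Ψ(L_∂)(e_k ⊗ t^m) = q^{−m} e_k ⊗ t^m; Ψ(K_{α_i}) = z_i Σ_{t=1}^N (Π_{s=0}^{t−1} x_{is}^{−1}) e_{tt}; Ψ(L_{α_i}) = z_i q^{−2(ε_N,α_i)} Σ_{t=1}^N (Π_{s=0}^{t−1} x_{si}) e_{tt}; Ψ(E_0) = z_0 u_0 d̄_1 q^{d̄_1}(q−q^{−1}) e_{N1} ⊗ t; Ψ(E_i) = −z_i u_i d̄_i q^{−d̄_i} (Π_{s=0}^{i−1} x_{is}^{−1})(q−q^{−1}) e_{i,i+1} for i ∈ {1,…,N−1};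 Ψ(F_0) = u_0^{−1} e_{1N} ⊗ t^{−1}; Ψ(F_i) = u_i^{−1} e_{i+1,i} for i ∈ {1,…,N−1}; and for a = c·∂ + Σ_{i∈I} c_i α_i ∈ V̂, Ψ(K_a) = Ψ(K_∂)^c Π_{i∈I} Ψ(K_{α_i})^{c_i} and Ψ(L_a) = Ψ(L_∂)^c Π_{i∈I} Ψ(L_{α_i})^{c_i}. -/
/-- Generators of the quantum superalgebra. -/
inductive QGen (Λ I : Type) : Type
  | Kg : Λ → QGen Λ I
  | Lg : Λ → QGen Λ I
  | Eg : I → QGen Λ I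
  | Fg : I → QGen Λ I

/-- The lattice `V̂ = (⊕_{i∈I} ℤα_i) ⊕ ℤ∂` for `I = {0,…,2n−1}`. -/
abbrev Lam (n : ℕ) : Type := (Fin (2 * n) → ℤ) × ℤ

/-- The simple roots `α_i` as elements of `V̂`. -/
def αr (n : ℕ) (i : Fin (2 * n)) : Lam n := (Pi.single i 1, 0)

/-- The element `∂` of `V̂`. -/
def dr (n : ℕ) : Lam n := (0, 1)

/-- `α` reindexed by `ℕ` (with junk value `0` out of range). -/
def αn (n : ℕ) (t : ℕ) : Lam n := if h : t < 2 * n then αr n ⟨t, h⟩ else 0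

/-- `δ̂ = α_0 + Σ_{t=1}^{N−1} α_t`. -/
def hatδ (n : ℕ) : Lam n := ∑ t ∈ Finset.range (2 * n), αn n t

/-- `ε`-coordinates of `α_i` : `α_0 = δ̂ − ε_1 + ε_N`, `α_i = ε_i − ε_{i+1}`
(`ε`-indices 0-based). -/
def wVec (n : ℕ) (i : ℕ) : Fin (2 * n) → ℤ := fun t =>
  if i = 0 then (if (t : ℕ) = 2 * n - 1 then 1 else 0) - (if (t : ℕ) = 0 then 1 else 0)
  else (if (t : ℕ) = i - 1 then 1 else 0) - (if (t : ℕ) = i then 1 else 0)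

/-- The bilinear-form values `(α_i, α_j)`, from `(ε_s,ε_t) = δ_{st} d̄_s`. -/
def Bfm (n : ℕ) (i j : ℕ) : ℤ :=
  ∑ t : Fin (2 * n), (if (t : ℕ) < n then 1 else -1) * wVec n i t * wVec n j t

/-- `(ε_N, α_i)`. -/
def epsNdot (n : ℕ) (i : ℕ) : ℤ :=
  ∑ t : Fin (2 * n), (if (t : ℕ) < n then 1 else -1)
    * (if (t : ℕ) = 2 * n - 1 then 1 else 0) * wVec n i t

section Defs

variable (K : Type) [Field K] (n : ℕ)

/-- The free algebra on the generators. -/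
abbrev FA : Type := FreeAlgebra K (QGen (Lam n) (Fin (2 * n)))

def fK (a : Lam n) : FA K n := FreeAlgebra.ι K (QGen.Kg a)
def fL (a : Lam n) : FA K n := FreeAlgebra.ι K (QGen.Lg a)
def fE (i : Fin (2 * n)) : FA K n := FreeAlgebra.ι K (QGen.Eg i)
def fF (i : Fin (2 * n)) : FA K n := FreeAlgebra.ι K (QGen.Fg i)

variable (χ : Lam n → Lam n → Kˣ)

/-- The `q`-bracket `⌊X,Y⌋ = XY − χ(μ,λ)⁻¹ YX` for `X` of degree `λ`, `Y` of
degree `μ` (free-algebra version, `E`-side). -/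
def fbrE (lam mu : Lam n) (X Y : FA K n) : FA K n :=
  X * Y - ((((χ mu lam)⁻¹ : Kˣ) : K)) • (Y * X)

/-- The corresponding bracket on the `F`-side: the coefficient `χ(μ,λ)⁻¹` is
replaced by `χ(λ,μ)⁻¹`. -/
def fbrF (lam mu : Lam n) (X Y : FA K n) : FA K n :=
  X * Y - ((((χ lam mu)⁻¹ : Kˣ) : K)) • (Y * X)

/-- The defining relations of the quantum affine superalgebra `U^♮_χ` of
`sl^{(1)}(n|n)`: the relations of `Ũ_χ` together with the Serre-type
relations for the `E_i` and the `F_i`. -/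
inductive NRel : FA K n → FA K n → Prop
  | K0 : NRel (fK K n 0) 1
  | L0 : NRel (fL K n 0) 1
  | KK (a b : Lam n) : NRel (fK K n a * fK K n b) (fK K n (a + b))
  | LL (a b : Lam n) : NRel (fL K n a * fL K n b) (fL K n (a + b))
  | KL (a b : Lam n) : NRel (fK K n a * fL K n b) (fL K n b * fK K n a)
  | KE (a : Lam n) (i : Fin (2 * n)) :
      NRel (fK K n a * fE K n i) ((χ a (αr n i) : K) • (fE K n i * fK K n a))
  | KF (a : Lam n) (i : Fin (2 * n)) :
      NRel (fK K n a * fF K n i) ((((χ a (αr n i))⁻¹ : Kˣ) : K) • (fF K n i * fK K n a))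
  | LE (a : Lam n) (i : Fin (2 * n)) :
      NRel (fL K n a * fE K n i) ((((χ (αr n i) a)⁻¹ : Kˣ) : K) • (fE K n i * fL K n a))
  | LF (a : Lam n) (i : Fin (2 * n)) :
      NRel (fL K n a * fF K n i) ((χ (αr n i) a : K) • (fF K n i * fL K n a))
  | EFsame (i : Fin (2 * n)) :
      NRel (fE K n i * fF K n i - fF K n i * fE K n i) (-fK K n (αr n i) + fL K n (αr n i))
  | EFne (i j : Fin (2 * n)) (h : i ≠ j) :
      NRel (fE K n i * fF K n j - fF K n j * fE K n i) 0
  | SE1 (i j : Fin (2 * n)) (h : Bfm n i j = 0) :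
      NRel (fbrE K n χ (αr n i) (αr n j) (fE K n i) (fE K n j)) 0
  | SE2 (i j : Fin (2 * n)) (hne : i ≠ j) (h1 : -(2 * Bfm n i j) = Bfm n i i)
      (h2 : Bfm n i i ≠ 0) :
      NRel (fbrE K n χ (αr n i) (αr n i + αr n j) (fE K n i)
        (fbrE K n χ (αr n i) (αr n j) (fE K n i) (fE K n j))) 0
  | SE3 (i j : Fin (2 * n)) (hne : i ≠ j) (h1 : -(Bfm n i j) = Bfm n i i)
      (h2 : Bfm n i i ≠ 0) :
      NRel (fbrE K n χ (αr n i) (αr n i + (αr n i + αr n j)) (fE K n i)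
        (fbrE K n χ (αr n i) (αr n i + αr n j) (fE K n i)
          (fbrE K n χ (αr n i) (αr n j) (fE K n i) (fE K n j)))) 0
  | SE4 (i j k : Fin (2 * n)) (h1 : i ≠ j) (h2 : j ≠ k) (h3 : k ≠ i)
      (h4 : Bfm n i i = 0) (h5 : Bfm n j k = 0)
      (h6 : -(Bfm n i j) = Bfm n i k) (h7 : Bfm n i k ≠ 0) :
      NRel (fbrE K n χ (αr n i + αr n j) (αr n i + αr n k)
        (fbrE K n χ (αr n i) (αr n j) (fE K n i) (fE K n j))
        (fbrE K n χ (αr n i) (αr n k) (fE K n i) (fE K n k))) 0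
  | SF1 (i j : Fin (2 * n)) (h : Bfm n i j = 0) :
      NRel (fbrF K n χ (αr n i) (αr n j) (fF K n i) (fF K n j)) 0
  | SF2 (i j : Fin (2 * n)) (hne : i ≠ j) (h1 : -(2 * Bfm n i j) = Bfm n i i)
      (h2 : Bfm n i i ≠ 0) :
      NRel (fbrF K n χ (αr n i) (αr n i + αr n j) (fF K n i)
        (fbrF K n χ (αr n i) (αr n j) (fF K n i) (fF K n j))) 0
  | SF3 (i j : Fin (2 * n)) (hne : i ≠ j) (h1 : -(Bfm n i j) = Bfm n i i)
      (h2 : Bfm n i i ≠ 0) :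
      NRel (fbrF K n χ (αr n i) (αr n i + (αr n i + αr n j)) (fF K n i)
        (fbrF K n χ (αr n i) (αr n i + αr n j) (fF K n i)
          (fbrF K n χ (αr n i) (αr n j) (fF K n i) (fF K n j)))) 0
  | SF4 (i j k : Fin (2 * n)) (h1 : i ≠ j) (h2 : j ≠ k) (h3 : k ≠ i)
      (h4 : Bfm n i i = 0) (h5 : Bfm n j k = 0)
      (h6 : -(Bfm n i j) = Bfm n i k) (h7 : Bfm n i k ≠ 0) :
      NRel (fbrF K n χ (αr n i + αr n j) (αr n i + αr n k)
        (fbrF K n χ (αr n i) (αr n j) (fF K n i) (fF K n j))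
        (fbrF K n χ (αr n i) (αr n k) (fF K n i) (fF K n k))) 0

/-- The quantum affine superalgebra `U^♮_χ` of `sl^{(1)}(n|n)`. -/
abbrev Unat : Type := RingQuot (NRel K n χ)

def uK (a : Lam n) : Unat K n χ := RingQuot.mkAlgHom K (NRel K n χ) (fK K n a)
def uL (a : Lam n) : Unat K n χ := RingQuot.mkAlgHom K (NRel K n χ) (fL K n a)
def uE (i : Fin (2 * n)) : Unat K n χ := RingQuot.mkAlgHom K (NRel K n χ) (fE K n i)
def uF (i : Fin (2 * n)) : Unat K n χ := RingQuot.mkAlgHom K (NRel K n χ) (fF K n i)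

/-- `E` reindexed by `ℕ` (junk value `0` out of range). -/
def uEn (t : ℕ) : Unat K n χ := if h : t < 2 * n then uE K n χ ⟨t, h⟩ else 0

/-- The `q`-bracket in `U^♮_χ` (for `X` of degree `λ` and `Y` of degree `μ`). -/
def ubrE (lam mu : Lam n) (X Y : Unat K n χ) : Unat K n χ :=
  X * Y - ((((χ mu lam)⁻¹ : Kˣ) : K)) • (Y * X)

/-- `deg B_i = Σ_{t=i+1}^{N−i−1} α_t`. -/
def degB (i : ℕ) : Lam n := ∑ t ∈ Finset.Icc (i + 1) (2 * n - i - 1), αn n t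

/-- `C j := B_{n−1−j}` : `C 0 = E_n`,
`C (j+1) = ⌊E_{n+j+1}, ⌊C j, E_{n−1−j}⌋⌋`. -/
def Cseq : ℕ → Unat K n χ
  | 0 => uEn K n χ n
  | j + 1 =>
      ubrE K n χ (αn n (n + j + 1)) (degB n (n - 1 - j) + αn n (n - 1 - j))
        (uEn K n χ (n + j + 1))
        (ubrE K n χ (degB n (n - 1 - j)) (αn n (n - 1 - j)) (Cseq j) (uEn K n χ (n - 1 - j)))

/-- `B_i` (for `i ∈ {0,…,n−1}`): `B_{n−1} = E_n`,
`B_i = ⌊E_{N−i−1}, ⌊B_{i+1}, E_{i+1}⌋⌋`. -/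
def Bseq (i : ℕ) : Unat K n χ := Cseq K n χ (n - 1 - i)

/-- `deg A_i = α_0 + Σ_{t=1}^{i} α_t + Σ_{t=N−i}^{N−1} α_t`. -/
def degA (i : ℕ) : Lam n :=
  αn n 0 + (∑ t ∈ Finset.Icc 1 i, αn n t) + ∑ t ∈ Finset.Icc (2 * n - i) (2 * n - 1), αn n t

/-- `A_0 = E_0`, `A_i = ⌊E_{N−i}, ⌊A_{i−1}, E_i⌋⌋`. -/
def Aseq : ℕ → Unat K n χ
  | 0 => uEn K n χ 0
  | i + 1 =>
      ubrE K n χ (αn n (2 * n - i - 1)) (degA n i + αn n (i + 1))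
        (uEn K n χ (2 * n - i - 1))
        (ubrE K n χ (degA n i) (αn n (i + 1)) (Aseq i) (uEn K n χ (i + 1)))

/-- The scalars `a_i`. -/
def aScal : ℕ → K
  | 0 => 1
  | i + 1 =>
      aScal i * (χ (hatδ n) (αn n (2 * n - i - 1)) : K)
        * (χ (-αn n (i + 1)) (∑ t ∈ Finset.Icc (i + 2) (2 * n - i - 2), αn n t) : K)
        * (χ (∑ t ∈ Finset.Icc (i + 1) (2 * n - i - 2), αn n t) (-αn n (2 * n - i - 1)) : K)

/-- The element `Z = Σ_{i=0}^{n−1} a_i ⌊A_i, B_i⌋` of `U^♮_χ`. -/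
def Zel : Unat K n χ :=
  ∑ i ∈ Finset.range n,
    aScal K n χ i • ubrE K n χ (degA n i) (degB n i) (Aseq K n χ i) (Bseq K n χ i)

end Defs

section Rep

variable (K : Type) [Field K] (n : ℕ)

/-- The representation space `K^N ⊗ K[t,t⁻¹]`, with basis `e_k ⊗ t^m`. -/
abbrev VRep : Type := (Fin (2 * n) × ℤ) →₀ K

/-- The basis vector `e_k ⊗ t^m`. -/
noncomputable def basV (k : Fin (2 * n)) (m : ℤ) : VRep K n := Finsupp.single (k, m) 1

/-- `d̄_i` (1-based), as an integer exponent. -/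
def dZ1 (i : ℕ) : ℤ := if i ≤ n then 1 else -1

/-- `d̄_i` (1-based), as a scalar. -/
def dK1 (i : ℕ) : K := if i ≤ n then 1 else -1

variable (χ : Lam n → Lam n → Kˣ) (q : Kˣ) (z u : Fin (2 * n) → Kˣ)

/-- The eigenvalue of `Ψ(K_{α_i})` on `e_k ⊗ t^m` (`k` 0-based):
`z_i Π_{s=0}^{k} x_{is}⁻¹`. -/
def lamK (i : Fin (2 * n)) (k : ℕ) : Kˣ :=
  z i * ∏ s ∈ Finset.range (k + 1), (χ (αr n i) (αn n s))⁻¹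

/-- The eigenvalue of `Ψ(L_{α_i})` on `e_k ⊗ t^m` (`k` 0-based):
`z_i q^{−2(ε_N,α_i)} Π_{s=0}^{k} x_{si}`. -/
def lamL (i : Fin (2 * n)) (k : ℕ) : Kˣ :=
  z i * q ^ (-(2 * epsNdot n i)) * ∏ s ∈ Finset.range (k + 1), χ (αn n s) (αr n i)

/-- The coefficient of `Ψ(E_0) = z_0u_0 d̄_1 q^{d̄_1}(q−q⁻¹) e_{N1} ⊗ t`. -/
def cE0 (hpos : 0 < n) : K :=
  ((z ⟨0, by omega⟩ * u ⟨0, by omega⟩ : Kˣ) : K) * dK1 K n 1 * ((q ^ dZ1 n 1 : Kˣ) : K)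
    * ((q : K) - ((q⁻¹ : Kˣ) : K))

/-- The coefficient of
`Ψ(E_i) = −z_iu_i d̄_i q^{−d̄_i}(Π_{s=0}^{i−1} x_{is}⁻¹)(q−q⁻¹) e_{i,i+1}`. -/
def cEi (i : Fin (2 * n)) : K :=
  -(((z i * u i : Kˣ) : K) * dK1 K n (i : ℕ) * ((q ^ (-dZ1 n (i : ℕ)) : Kˣ) : K)
    * ((∏ s ∈ Finset.range (i : ℕ), (χ (αr n i) (αn n s))⁻¹ : Kˣ) : K)
    * ((q : K) - ((q⁻¹ : Kˣ) : K)))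

end Rep

namespace VR

theorem aux1 {n : ℕ} (i : Fin (2 * n)) : 2 * n - 1 < 2 * n := by have := i.2; omega

theorem aux2 {n : ℕ} (i : Fin (2 * n)) : (i : ℕ) - 1 < 2 * n := by have := i.2; omega

def prd {n : ℕ} (i : Fin (2 * n)) : Fin (2 * n) :=
  if (i : ℕ) = 0 then ⟨2 * n - 1, aux1 i⟩ else ⟨(i : ℕ) - 1, aux2 i⟩

theorem prd_val {n : ℕ} (i : Fin (2 * n)) :
    ((prd i : Fin (2 * n)) : ℕ) = if (i : ℕ) = 0 then 2 * n - 1 else (i : ℕ) - 1 := by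
  unfold prd; split_ifs <;> rfl

theorem prd_inj {n : ℕ} {i j : Fin (2 * n)} (h : prd i = prd j) : i = j := by
  have h := congrArg Fin.val h
  rw [prd_val, prd_val] at h
  apply Fin.ext
  have := i.2; have := j.2
  split_ifs at h <;> omega

theorem prd_ne {n : ℕ} (hn : 2 ≤ n) (i : Fin (2 * n)) : prd i ≠ i := by
  intro h
  have h := congrArg Fin.val h
  rw [prd_val] at h
  split_ifs at h <;> omega

theorem prd2_ne {n : ℕ} (hn : 2 ≤ n) (i : Fin (2 * n)) : prd (prd i) ≠ i := by
  intro h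
  have h := congrArg Fin.val h
  rw [prd_val, prd_val] at h
  split_ifs at h <;> omega

theorem prd3_ne {n : ℕ} (hn : 2 ≤ n) (i : Fin (2 * n)) : prd (prd (prd i)) ≠ i := by
  intro h
  have h := congrArg Fin.val h
  rw [prd_val, prd_val, prd_val] at h
  split_ifs at h <;> omega

theorem wVec_eq {n : ℕ} (i t : Fin (2 * n)) :
    wVec n i t = (if t = prd i then 1 else 0) - (if t = i then 1 else 0) := by
  have h1 : (t = prd i) ↔ (t : ℕ) = if (i : ℕ) = 0 then 2 * n - 1 else (i : ℕ) - 1 := by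
    rw [Fin.ext_iff, prd_val]
  unfold wVec
  by_cases h : (i : ℕ) = 0
  · simp [h1, h, Fin.ext_iff]
  · simp [h1, h, Fin.ext_iff]

theorem sum_wVec {n : ℕ} (t : Fin (2 * n)) (k : ℕ) :
    ∑ s ∈ Finset.range (k + 1), wVec n s t
      = (if (t : ℕ) = 2 * n - 1 then 1 else 0) - (if (t : ℕ) = k then 1 else 0) := by
  induction k with
  | zero => simp [wVec]
  | succ k ih =>
    rw [Finset.sum_range_succ, ih]
    simp [wVec]

def dd (n : ℕ) (t : Fin (2 * n)) : ℤ := if (t : ℕ) < n then 1 else -1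

theorem sum_Bfm {n : ℕ} (i k : Fin (2 * n)) :
    ∑ s ∈ Finset.range ((k : ℕ) + 1), Bfm n i s = epsNdot n i - dd n k * wVec n i k := by
  unfold Bfm epsNdot
  rw [Finset.sum_comm]
  have : ∀ t : Fin (2 * n), ∑ s ∈ Finset.range ((k : ℕ) + 1),
      (if (t : ℕ) < n then (1 : ℤ) else -1) * wVec n i t * wVec n s t
      = (if (t : ℕ) < n then 1 else -1)
    * (if (t : ℕ) = 2 * n - 1 then 1 else 0) * wVec n i t
      - if t = k then dd n t * wVec n i t else 0 := by
    intro t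
    rw [← Finset.mul_sum, sum_wVec]
    simp only [Fin.ext_iff, dd]
    split_ifs <;> ring
  rw [Finset.sum_congr rfl (fun t _ => this t), Finset.sum_sub_distrib]
  simp

theorem sum_Bfm_all {n : ℕ} (i : Fin (2 * n)) :
    ∑ s ∈ Finset.range (2 * n), Bfm n i s = 0 := by
  have hN : 2 * n = (2 * n - 1) + 1 := by have := i.2; omega
  unfold Bfm
  rw [Finset.sum_comm]
  apply Finset.sum_eq_zero
  intro t _
  rw [← Finset.mul_sum]
  have h := sum_wVec t (2 * n - 1)
  rw [← hN] at h
  rw [h]; simp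

theorem Bfm_comm (n i j : ℕ) : Bfm n i j = Bfm n j i := by
  unfold Bfm
  apply Finset.sum_congr rfl
  intros; ring

theorem Bfm_prd {n : ℕ} (hn : 2 ≤ n) (i : Fin (2 * n)) : Bfm n i (prd i) ≠ 0 := by
  have : Bfm n i (prd i) = - dd n (prd i) := by
    unfold Bfm
    rw [Finset.sum_eq_single (prd i)]
    · rw [wVec_eq, wVec_eq]
      simp [prd_ne hn, (prd_ne hn (prd i)).symm, dd]
    · intro t _ ht
      rw [wVec_eq, wVec_eq]
      by_cases h : t = i
      · subst h
        simp [(prd2_ne hn t).symm, (prd_ne hn t).symm]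
      · simp [h, ht]
    · simp
  rw [this]; unfold dd; split_ifs <;> simp

theorem Bfm_self {n : ℕ} (hn : 2 ≤ n) (i : Fin (2 * n)) : Bfm n i i = dd n (prd i) + dd n i := by
  unfold Bfm
  have : ∀ t : Fin (2 * n), (if (t : ℕ) < n then (1 : ℤ) else -1) * wVec n i t * wVec n i t
     = (if t = prd i then dd n t else 0) + (if t = i then dd n t else 0) := by
    intro t
    rw [wVec_eq]
    by_cases h : t = i
    · subst h
      simp [(prd_ne hn t).symm, dd]
    · by_cases h' : t = prd i <;> simp [h, h', dd, prd_ne hn]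
  rw [Finset.sum_congr rfl (fun t _ => this t), Finset.sum_add_distrib]
  simp

theorem lam_decomp {n : ℕ} (a : Lam n) : a = a.2 • dr n + ∑ i, a.1 i • αr n i := by
  apply Prod.ext
  · funext j
    simp [dr, αr, Prod.fst_sum, Finset.sum_apply, Pi.single_apply]
  · simp [dr, αr, Prod.snd_sum]

theorem lam_coords {n : ℕ} (c : ℤ) (cc : Fin (2 * n) → ℤ) :
    c • dr n + ∑ i, cc i • αr n i = (cc, c) := (lam_decomp (cc, c)).symm

theorem hom_decomp {G : Type} [CommGroup G] {n : ℕ} (f : Lam n → G)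
    (hf : ∀ a b, f (a + b) = f a * f b) (a : Lam n) :
    f a = f (dr n) ^ a.2 * ∏ i, f (αr n i) ^ a.1 i := by
  let g : Lam n →+ Additive G := AddMonoidHom.mk' (fun a => Additive.ofMul (f a))
    (fun a b => by rw [hf]; rfl)
  have h : g a = a.2 • g (dr n) + ∑ i, a.1 i • g (αr n i) := by
    conv_lhs => rw [lam_decomp a]
    simp only [map_add, map_sum, map_zsmul]
  exact h

theorem hom_sum {G : Type} [CommGroup G] {n : ℕ} (f : Lam n → G)
    (hf : ∀ a b, f (a + b) = f a * f b) (s : Finset ℕ) (v : ℕ → Lam n) :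
    f (∑ t ∈ s, v t) = ∏ t ∈ s, f (v t) := by
  let g : Lam n →+ Additive G := AddMonoidHom.mk' (fun a => Additive.ofMul (f a))
    (fun a b => by rw [hf]; rfl)
  exact map_sum g v s

section
variable {K : Type} [Field K] {n : ℕ}

noncomputable def mkOp (f : Fin (2 * n) → ℤ → VRep K n) : Module.End K (VRep K n) :=
  Finsupp.linearCombination K (fun p : Fin (2 * n) × ℤ => f p.1 p.2)

theorem mkOp_bas (f : Fin (2 * n) → ℤ → VRep K n) (k : Fin (2 * n)) (m : ℤ) :
    mkOp f (basV K n k m) = f k m := by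
  simp [mkOp, basV]

theorem op_ext {A B : Module.End K (VRep K n)}
    (h : ∀ k m, A (basV K n k m) = B (basV K n k m)) : A = B := by
  apply Finsupp.lhom_ext'
  rintro ⟨k, m⟩
  apply LinearMap.ext_ring
  exact h k m

def sh (i : Fin (2 * n)) : ℤ := if (i : ℕ) = 0 then 1 else 0

noncomputable def opE (c : Fin (2 * n) → K) (i : Fin (2 * n)) : Module.End K (VRep K n) :=
  mkOp fun k m => if k = i then c i • basV K n (prd i) (m + sh i) else 0

noncomputable def opF (c : Fin (2 * n) → K) (i : Fin (2 * n)) : Module.End K (VRep K n) :=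
  mkOp fun k m => if k = prd i then c i • basV K n i (m - sh i) else 0

noncomputable def opD (κ : Fin (2 * n) → ℤ → Kˣ) : Module.End K (VRep K n) :=
  mkOp fun k m => ((κ k m : Kˣ) : K) • basV K n k m

theorem opE_bas (c : Fin (2 * n) → K) (i k : Fin (2 * n)) (m : ℤ) :
    opE c i (basV K n k m) = if k = i then c i • basV K n (prd i) (m + sh i) else 0 :=
  mkOp_bas _ _ _

theorem opF_bas (c : Fin (2 * n) → K) (i k : Fin (2 * n)) (m : ℤ) :
    opF c i (basV K n k m) = if k = prd i then c i • basV K n i (m - sh i) else 0 :=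
  mkOp_bas _ _ _

theorem opD_bas (κ : Fin (2 * n) → ℤ → Kˣ) (k : Fin (2 * n)) (m : ℤ) :
    opD κ (basV K n k m) = ((κ k m : Kˣ) : K) • basV K n k m :=
  mkOp_bas _ _ _

theorem opE_mul (c : Fin (2 * n) → K) {i j : Fin (2 * n)} (h : prd j ≠ i) :
    opE c i * opE c j = 0 := by
  apply op_ext
  intro k m
  rw [Module.End.mul_apply, opE_bas]
  split_ifs <;> simp [opE_bas, h]

theorem opF_mul (c : Fin (2 * n) → K) {i j : Fin (2 * n)} (h : prd i ≠ j) :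
    opF c i * opF c j = 0 := by
  apply op_ext
  intro k m
  rw [Module.End.mul_apply, opF_bas]
  split_ifs <;> simp [opF_bas, h.symm]

/-- cyclic-nilpotency properties enough for the Serre relations. -/
structure Nil {A : Type} [Ring A] (X : Fin (2 * n) → A) : Prop where
  h2 : ∀ i, X i * X i = 0
  h3 : ∀ i j, X i * (X j * X i) = 0
  h4 : ∀ i j k, X i * (X j * (X k * X i)) = 0

theorem opE_nil (hn : 2 ≤ n) (c : Fin (2 * n) → K) : Nil (opE c) where
  h2 i := opE_mul c (prd_ne hn i)
  h3 i j := by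
    by_cases h : prd i = j
    · rw [← mul_assoc, opE_mul (i := i) (j := j), zero_mul]
      subst h; exact prd2_ne hn i
    · rw [opE_mul c h, mul_zero]
  h4 i j k := by
    by_cases h : prd i = k
    · by_cases h' : prd k = j
      · rw [← mul_assoc, opE_mul (i := i) (j := j), zero_mul]
        subst h'; subst h; exact prd3_ne hn i
      · rw [← mul_assoc (opE c j), opE_mul c h', zero_mul, mul_zero]
    · rw [opE_mul c h, mul_zero, mul_zero]

theorem opF_nil (hn : 2 ≤ n) (c : Fin (2 * n) → K) : Nil (opF c) where
  h2 i := opF_mul c (prd_ne hn i)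
  h3 i j := by
    by_cases h : prd j = i
    · rw [← mul_assoc, opF_mul (i := i) (j := j), zero_mul]
      subst h; exact prd2_ne hn j
    · rw [opF_mul c h, mul_zero]
  h4 i j k := by
    by_cases h : prd k = i
    · by_cases h' : prd j = k
      · rw [← mul_assoc, opF_mul (i := i) (j := j), zero_mul]
        subst h; subst h'; exact prd3_ne hn j
      · rw [← mul_assoc (opF c j), opF_mul c h', zero_mul, mul_zero]
    · rw [opF_mul c h, mul_zero, mul_zero]

variable {A : Type} [Ring A] [Algebra K A]

def br (r : K) (X Y : A) : A := X * Y - r • (Y * X)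

theorem nil_se2 {X : Fin (2 * n) → A} (h : Nil X) (r s : K) (i j : Fin (2 * n)) :
    br r (X i) (br s (X i) (X j)) = 0 := by
  have e1 : X i * (X i * X j) = 0 := by rw [← mul_assoc, h.h2, zero_mul]
  simp [br, mul_sub, sub_mul, mul_assoc, h.h2, h.h3, e1]

theorem nil_se4 {X : Fin (2 * n) → A} (h : Nil X) (r s t : K) (i j k : Fin (2 * n)) :
    br r (br s (X i) (X j)) (br t (X i) (X k)) = 0 := by
  have e1 : ∀ i Y, X i * (X i * Y) = 0 := by intro i Y; rw [← mul_assoc, h.h2, zero_mul]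
  have e2 : ∀ i j Y, X i * (X j * (X i * Y)) = 0 := by
    intro i j Y; rw [← mul_assoc (X j), ← mul_assoc, h.h3, zero_mul]
  simp [br, mul_sub, sub_mul, mul_assoc, h.h3, h.h4, e1, e2]

end

section main
variable {K : Type} [Field K] {n : ℕ} {q : Kˣ} {χ : Lam n → Lam n → Kˣ}

theorem αn_val (s : Fin (2 * n)) : αn n s = αr n s := by
  simp [αn]

theorem prod_zpow_sum (q : Kˣ) (s : Finset ℕ) (f : ℕ → ℤ) :
    ∏ t ∈ s, q ^ f t = q ^ ∑ t ∈ s, f t := by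
  classical
  induction s using Finset.induction_on with
  | empty => simp
  | insert a s ha ih => rw [Finset.prod_insert ha, Finset.sum_insert ha, ih, zpow_add]

theorem cartan
    (hχd : ∀ i : Fin (2 * n), Bfm n i i ≠ 0 → χ (αr n i) (αr n i) = q ^ (Bfm n i i))
    (hχ0 : ∀ i : Fin (2 * n), Bfm n i i = 0 → ((χ (αr n i) (αr n i) : Kˣ) : K) = -1)
    (hχij : ∀ i j : Fin (2 * n), i ≠ j →
      χ (αr n i) (αr n j) * χ (αr n j) (αr n i) = q ^ (2 * Bfm n i j))
    (i : Fin (2 * n)) (s : ℕ) (hs : s < 2 * n) :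
    χ (αn n s) (αr n i) = (χ (αr n i) (αn n s))⁻¹ * q ^ (2 * Bfm n i s) := by
  have e : αn n s = αr n ⟨s, hs⟩ := αn_val ⟨s, hs⟩
  rw [e, eq_inv_mul_iff_mul_eq]
  by_cases h : i = ⟨s, hs⟩
  · subst h
    by_cases h0 : Bfm n s s = 0
    · have := hχ0 ⟨s, hs⟩ h0
      rw [h0]
      ext
      simp [this]
    · rw [hχd ⟨s, hs⟩ h0, ← zpow_add]
      congr 1
      exact (two_mul _).symm
  · exact hχij i ⟨s, hs⟩ h

theorem lamL_eq
    (hc : ∀ (i : Fin (2 * n)) (s : ℕ), s < 2 * n →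
      χ (αn n s) (αr n i) = (χ (αr n i) (αn n s))⁻¹ * q ^ (2 * Bfm n i s))
    (z : Fin (2 * n) → Kˣ) (i k : Fin (2 * n)) :
    lamL K n χ q z i k = lamK K n χ z i k * q ^ (-(2 * (dd n k * wVec n i k))) := by
  unfold lamL lamK
  have : ∏ s ∈ Finset.range ((k : ℕ) + 1), χ (αn n s) (αr n i)
      = (∏ s ∈ Finset.range ((k : ℕ) + 1), (χ (αr n i) (αn n s))⁻¹)
        * q ^ (2 * (epsNdot n i - dd n k * wVec n i k)) := by
    rw [← sum_Bfm, Finset.mul_sum, ← prod_zpow_sum, ← Finset.prod_mul_distrib]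
    apply Finset.prod_congr rfl
    intro s hs
    apply hc
    have := k.2
    have := Finset.mem_range.1 hs
    omega
  rw [this, mul_assoc, mul_assoc, mul_left_comm (q ^ _), ← zpow_add]
  congr 3
  ring

theorem prod_one
    (hχ2 : ∀ a b c : Lam n, χ a (b + c) = χ a b * χ a c)
    (hδ : ∀ i : Fin (2 * n), χ (αr n i) (hatδ n) = 1) (i : Fin (2 * n)) :
    ∏ s ∈ Finset.range (2 * n), (χ (αr n i) (αn n s))⁻¹ = 1 := by
  rw [Finset.prod_inv_distrib, ← hom_sum (χ (αr n i)) (hχ2 _)]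
  rw [show ∑ t ∈ Finset.range (2 * n), αn n t = hatδ n from rfl, hδ, inv_one]

theorem prod_one'
    (hc : ∀ (i : Fin (2 * n)) (s : ℕ), s < 2 * n →
      χ (αn n s) (αr n i) = (χ (αr n i) (αn n s))⁻¹ * q ^ (2 * Bfm n i s))
    (hp : ∀ i : Fin (2 * n), ∏ s ∈ Finset.range (2 * n), (χ (αr n i) (αn n s))⁻¹ = 1)
    (i : Fin (2 * n)) :
    ∏ s ∈ Finset.range (2 * n), χ (αn n s) (αr n i) = 1 := by
  rw [Finset.prod_congr rfl (fun s hs => hc i s (Finset.mem_range.1 hs)),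
    Finset.prod_mul_distrib, hp, one_mul, prod_zpow_sum, ← Finset.mul_sum,
    sum_Bfm_all]
  simp

theorem prod_step (f : ℕ → Kˣ) (h : ∏ s ∈ Finset.range (2 * n), f s = 1) (i : Fin (2 * n)) :
    ∏ s ∈ Finset.range (((prd i : Fin (2 * n)) : ℕ) + 1), f s = (f i)⁻¹ *
      ∏ s ∈ Finset.range ((i : ℕ) + 1), f s := by
  have := i.2
  rw [prd_val]
  split_ifs with h0
  · rw [show 2 * n - 1 + 1 = 2 * n by omega, h, h0]
    simp
  · rw [show (i : ℕ) - 1 + 1 = i by omega, Finset.prod_range_succ]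
    rw [mul_comm (∏ s ∈ _, _), inv_mul_cancel_left]

theorem lamK_step
    (hp : ∀ i : Fin (2 * n), ∏ s ∈ Finset.range (2 * n), (χ (αr n i) (αn n s))⁻¹ = 1)
    (z : Fin (2 * n) → Kˣ) (j i : Fin (2 * n)) :
    lamK K n χ z j (prd i : Fin (2 * n)) = χ (αr n j) (αr n i) * lamK K n χ z j i := by
  unfold lamK
  rw [prod_step _ (hp j), αn_val, inv_inv, mul_left_comm]

theorem lamL_step
    (hp : ∀ i : Fin (2 * n), ∏ s ∈ Finset.range (2 * n), χ (αn n s) (αr n i) = 1)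
    (z : Fin (2 * n) → Kˣ) (j i : Fin (2 * n)) :
    lamL K n χ q z j (prd i : Fin (2 * n)) = (χ (αr n i) (αr n j))⁻¹ * lamL K n χ q z j i := by
  unfold lamL
  rw [prod_step (fun s => χ (αn n s) (αr n j)) (hp j), αn_val, mul_left_comm]

def kap (lam : Fin (2 * n) → ℕ → Kˣ) (q : Kˣ) (a : Lam n) (k : Fin (2 * n)) (m : ℤ) : Kˣ :=
  q ^ (a.2 * m) * ∏ i, lam i k ^ a.1 i

theorem kap_add (lam : Fin (2 * n) → ℕ → Kˣ) (q : Kˣ) (a b : Lam n) (k : Fin (2 * n)) (m : ℤ) :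
    kap lam q (a + b) k m = kap lam q a k m * kap lam q b k m := by
  simp only [kap, Prod.snd_add, Prod.fst_add, Pi.add_apply, add_mul, zpow_add,
    Finset.prod_mul_distrib]
  exact mul_mul_mul_comm _ _ _ _

theorem kap_zero (lam : Fin (2 * n) → ℕ → Kˣ) (q : Kˣ) (k : Fin (2 * n)) (m : ℤ) :
    kap lam q 0 k m = 1 := by
  simp [kap]

theorem kap_dr (lam : Fin (2 * n) → ℕ → Kˣ) (q : Kˣ) (k : Fin (2 * n)) (m : ℤ) :
    kap lam q (dr n) k m = q ^ m := by
  simp [kap, dr]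

theorem kap_αr (lam : Fin (2 * n) → ℕ → Kˣ) (q : Kˣ) (i k : Fin (2 * n)) (m : ℤ) :
    kap lam q (αr n i) k m = lam i k := by
  unfold kap αr
  rw [Finset.prod_eq_single i]
  · simp
  · intro j _ hj; simp [hj]
  · simp

theorem kap_step (lam : Fin (2 * n) → ℕ → Kˣ) (q : Kˣ) (f : Lam n → Kˣ)
    (hf : ∀ a b, f (a + b) = f a * f b) (i : Fin (2 * n))
    (h1 : ∀ j, lam j (prd i : Fin (2 * n)) = f (αr n j) * lam j i)
    (h2 : q ^ sh i = f (dr n)) (a : Lam n) (m : ℤ) :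
    kap lam q a (prd i) (m + sh i) = f a * kap lam q a i m := by
  rw [hom_decomp f hf a]
  unfold kap
  simp only [h1, mul_zpow, Finset.prod_mul_distrib]
  rw [← h2, mul_add, zpow_add, ← zpow_mul, mul_comm (sh i)]
  rw [mul_comm (q ^ (a.2 * m))]
  exact mul_mul_mul_comm _ _ _ _

/-- uniform coefficient of `E_i`. -/
def cU (χ : Lam n → Lam n → Kˣ) (q : Kˣ) (z u : Fin (2 * n) → Kˣ) (i : Fin (2 * n)) : K :=
  (u i : K) * ((lamL K n χ q z i (prd i : Fin (2 * n)) : K)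
    - (lamK K n χ z i (prd i : Fin (2 * n)) : K))

theorem dd_cases (t : Fin (2 * n)) : dd n t = 1 ∨ dd n t = -1 := by
  unfold dd; split_ifs <;> simp

theorem w_prd (hn : 2 ≤ n) (i : Fin (2 * n)) : wVec n i (prd i) = 1 := by
  rw [wVec_eq]; simp [prd_ne hn]

theorem second (hn : 2 ≤ n)
    (hχd : ∀ i : Fin (2 * n), Bfm n i i ≠ 0 → χ (αr n i) (αr n i) = q ^ (Bfm n i i))
    (hχ0 : ∀ i : Fin (2 * n), Bfm n i i = 0 → ((χ (αr n i) (αr n i) : Kˣ) : K) = -1)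
    (z : Fin (2 * n) → Kˣ)
    (hL : ∀ i k : Fin (2 * n),
      lamL K n χ q z i k = lamK K n χ z i k * q ^ (-(2 * (dd n k * wVec n i k))))
    (hKs : ∀ j i : Fin (2 * n),
      lamK K n χ z j (prd i : Fin (2 * n)) = χ (αr n j) (αr n i) * lamK K n χ z j i)
    (hLs : ∀ j i : Fin (2 * n),
      lamL K n χ q z j (prd i : Fin (2 * n)) = (χ (αr n i) (αr n j))⁻¹ * lamL K n χ q z j i)
    (i : Fin (2 * n)) :
    (lamL K n χ q z i i : K) - (lamK K n χ z i i : K)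
      = -((lamL K n χ q z i (prd i : Fin (2 * n)) : K)
          - (lamK K n χ z i (prd i : Fin (2 * n)) : K)) := by
  have e1 : lamL K n χ q z i i = χ (αr n i) (αr n i) * lamL K n χ q z i (prd i : Fin (2 * n)) := by
    rw [hLs, mul_inv_cancel_left]
  have e2 : lamK K n χ z i i
      = (χ (αr n i) (αr n i))⁻¹ * lamK K n χ z i (prd i : Fin (2 * n)) := by
    rw [hKs, inv_mul_cancel_left]
  have e3 := hL i (prd i)
  rw [w_prd hn, mul_one] at e3
  rw [e1, e2, e3]
  have hB := Bfm_self hn i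
  by_cases h0 : Bfm n i i = 0
  · have := hχ0 i h0
    push_cast
    rw [this]
    simp; ring
  · have h1 : Bfm n i i = 2 * dd n (prd i) := by
      rcases dd_cases i with h | h <;> rcases dd_cases (prd i) with h' | h' <;>
        omega
    have := hχd i h0
    rw [h1] at this
    rw [this, mul_left_comm, ← zpow_add, ← zpow_neg, add_neg_cancel, zpow_zero, mul_one]
    push_cast
    ring

theorem cU_zero (hn : 2 ≤ n) (z u : Fin (2 * n) → Kˣ)
    (hL : ∀ i k : Fin (2 * n),
      lamL K n χ q z i k = lamK K n χ z i k * q ^ (-(2 * (dd n k * wVec n i k))))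
    (hp : ∀ i : Fin (2 * n), ∏ s ∈ Finset.range (2 * n), (χ (αr n i) (αn n s))⁻¹ = 1)
    (i : Fin (2 * n)) (hi : (i : ℕ) = 0) (hpos : 0 < n) :
    cU χ q z u i = cE0 K n q z u hpos := by
  obtain ⟨i, hlt⟩ := i
  obtain rfl : i = 0 := hi
  unfold cU cE0
  rw [hL, w_prd hn]
  have hd : dd n (prd ⟨0, hlt⟩) = -1 := by
    unfold dd; rw [prd_val]; simp; omega
  have hK : lamK K n χ z ⟨0, hlt⟩ (prd (⟨0, hlt⟩ : Fin (2 * n)) : Fin (2 * n))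
      = z ⟨0, hlt⟩ := by
    unfold lamK
    rw [prd_val, if_pos rfl, show 2 * n - 1 + 1 = 2 * n by omega, hp, mul_one]
  have h1 : 1 ≤ n := by omega
  rw [hK, hd]
  simp [dK1, dZ1, h1]
  have := q.ne_zero
  field_simp

theorem cU_pos (hn : 2 ≤ n) (z u : Fin (2 * n) → Kˣ)
    (hL : ∀ i k : Fin (2 * n),
      lamL K n χ q z i k = lamK K n χ z i k * q ^ (-(2 * (dd n k * wVec n i k))))
    (i : Fin (2 * n)) (hi : (i : ℕ) ≠ 0) :
    cU χ q z u i = cEi K n χ q z u i := by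
  unfold cU cEi
  rw [hL, w_prd hn]
  have hd : dd n (prd i) = dZ1 n i := by
    unfold dd dZ1; rw [prd_val, if_neg hi]
    have : (i : ℕ) - 1 < n ↔ (i : ℕ) ≤ n := by omega
    simp [this]
  have hK : lamK K n χ z i (prd i : Fin (2 * n))
      = z i * ∏ s ∈ Finset.range (i : ℕ), (χ (αr n i) (αn n s))⁻¹ := by
    unfold lamK
    rw [prd_val, if_neg hi, show (i : ℕ) - 1 + 1 = i by omega]
  rw [hK, hd]
  generalize ∏ s ∈ Finset.range (i : ℕ), (χ (αr n i) (αn n s))⁻¹ = P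
  have := q.ne_zero
  unfold dK1 dZ1
  split_ifs
  · simp only [mul_one, zpow_neg, Units.val_mul, Units.val_inv_eq_inv_val, Units.val_zpow_eq_zpow_val, zpow_one, zpow_ofNat, Units.val_pow_eq_pow_val]
    field_simp
    ring
  · simp only [mul_one, mul_neg, neg_neg, zpow_neg, Units.val_mul, Units.val_inv_eq_inv_val, Units.val_zpow_eq_zpow_val, zpow_one, zpow_ofNat, Units.val_pow_eq_pow_val]
    field_simp

theorem opDE (κ : Fin (2 * n) → ℤ → Kˣ) (c : Fin (2 * n) → K) (i : Fin (2 * n)) (r : Kˣ)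
    (h : ∀ m, κ (prd i) (m + sh i) = r * κ i m) :
    opD κ * opE c i = (r : K) • (opE c i * opD κ) := by
  apply op_ext
  intro k m
  rw [LinearMap.smul_apply, Module.End.mul_apply, Module.End.mul_apply, opE_bas, opD_bas,
    map_smul, opE_bas]
  split_ifs with hk
  · subst hk
    rw [map_smul, opD_bas, h, smul_smul, smul_smul, smul_smul]
    congr 1
    push_cast; ring
  · simp

theorem opDF (κ : Fin (2 * n) → ℤ → Kˣ) (c : Fin (2 * n) → K) (i : Fin (2 * n)) (r : Kˣ)
    (h : ∀ m, κ (prd i) (m + sh i) = r * κ i m) :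
    opD κ * opF c i = ((r⁻¹ : Kˣ) : K) • (opF c i * opD κ) := by
  apply op_ext
  intro k m
  rw [LinearMap.smul_apply, Module.End.mul_apply, Module.End.mul_apply, opF_bas, opD_bas,
    map_smul, opF_bas]
  split_ifs with hk
  · subst hk
    have h' := h (m - sh i)
    rw [sub_add_cancel] at h'
    rw [map_smul, opD_bas, h', smul_smul, smul_smul, smul_smul]
    congr 1
    push_cast
    field_simp
  · simp

theorem opEF_ne (c d : Fin (2 * n) → K) (i j : Fin (2 * n)) (h : i ≠ j) :
    opE c i * opF d j - opF d j * opE c i = 0 := by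
  apply op_ext
  intro k m
  rw [LinearMap.sub_apply, Module.End.mul_apply, Module.End.mul_apply, opF_bas, opE_bas]
  have h1 : prd i ≠ prd j := fun hh => h (prd_inj hh)
  split_ifs <;> simp [opE_bas, opF_bas, h.symm, h1]

theorem opEF_same (hn : 2 ≤ n) (c d : Fin (2 * n) → K) (i : Fin (2 * n))
    (κ μ : Fin (2 * n) → ℤ → Kˣ)
    (h1 : ∀ m, (μ (prd i) m : K) - κ (prd i) m = c i * d i)
    (h2 : ∀ m, (μ i m : K) - κ i m = -(c i * d i))
    (h3 : ∀ k m, k ≠ i → k ≠ prd i → μ k m = κ k m) :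
    opE c i * opF d i - opF d i * opE c i = - opD κ + opD μ := by
  apply op_ext
  intro k m
  rw [LinearMap.sub_apply, Module.End.mul_apply, Module.End.mul_apply, opF_bas, opE_bas,
    LinearMap.add_apply, LinearMap.neg_apply, opD_bas, opD_bas, neg_add_eq_sub, ← sub_smul]
  by_cases hi : k = i
  · subst hi
    rw [h2]
    simp [(prd_ne hn k).symm, opF_bas, smul_smul]
  · by_cases hp : k = prd i
    · subst hp
      rw [h1]
      simp [prd_ne hn, opE_bas, smul_smul, mul_comm]
    · rw [h3 k m hi hp]
      simp [hi, hp]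

end main

end VR

open VR

/-- existence of the vector representation
`Ψ : U^♮_χ → End_K(K^N ⊗ K[t,t⁻¹])` of the quantum affine superalgebra of
`sl^{(1)}(n|n)` (the operators are described through their action on the basis
`e_k ⊗ t^m`; the operators `Ψ(K_a)`, `Ψ(L_a)` are diagonal, so the last two
conditions express `Ψ(K_a) = Ψ(K_∂)^c Π_i Ψ(K_{α_i})^{c_i}` and its `L`-analogue
for `a = c∂ + Σ_i c_i α_i`). -/
theorem stmt10 (K : Type) [Field K] [CharZero K] (n : ℕ) (hn : 2 ≤ n)
    (q : Kˣ) (hq : ∀ m : ℕ, 0 < m → (q : K) ^ m ≠ 1)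
    (χ : Lam n → Lam n → Kˣ)
    (hχ1 : ∀ a b c : Lam n, χ (a + b) c = χ a c * χ b c)
    (hχ2 : ∀ a b c : Lam n, χ a (b + c) = χ a b * χ a c)
    (hχd : ∀ i : Fin (2 * n), Bfm n i i ≠ 0 → χ (αr n i) (αr n i) = q ^ (Bfm n i i))
    (hχ0 : ∀ i : Fin (2 * n), Bfm n i i = 0 → ((χ (αr n i) (αr n i) : Kˣ) : K) = -1)
    (hχij : ∀ i j : Fin (2 * n), i ≠ j →
      χ (αr n i) (αr n j) * χ (αr n j) (αr n i) = q ^ (2 * Bfm n i j))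
    (hχdd : χ (dr n) (dr n) = 1)
    (hχdi : ∀ i : Fin (2 * n),
      χ (dr n) (αr n i) = q ^ (if (i : ℕ) = 0 then (1 : ℕ) else 0) ∧
      χ (αr n i) (dr n) = q ^ (if (i : ℕ) = 0 then (1 : ℕ) else 0))
    (hδ : ∀ i : Fin (2 * n), χ (αr n i) (hatδ n) = 1)
    (z u : Fin (2 * n) → Kˣ) :
    ∃ Ψ : Unat K n χ →ₐ[K] Module.End K (VRep K n),
      (∀ (k : Fin (2 * n)) (m : ℤ),
        Ψ (uK K n χ (dr n)) (basV K n k m) = ((q ^ m : Kˣ) : K) • basV K n k m) ∧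
      (∀ (k : Fin (2 * n)) (m : ℤ),
        Ψ (uL K n χ (dr n)) (basV K n k m) = ((q ^ (-m) : Kˣ) : K) • basV K n k m) ∧
      (∀ (i : Fin (2 * n)) (k : Fin (2 * n)) (m : ℤ),
        Ψ (uK K n χ (αr n i)) (basV K n k m)
          = ((lamK K n χ z i (k : ℕ) : Kˣ) : K) • basV K n k m) ∧
      (∀ (i : Fin (2 * n)) (k : Fin (2 * n)) (m : ℤ),
        Ψ (uL K n χ (αr n i)) (basV K n k m)
          = ((lamL K n χ q z i (k : ℕ) : Kˣ) : K) • basV K n k m) ∧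
      (∀ (k : Fin (2 * n)) (m : ℤ),
        Ψ (uE K n χ ⟨0, by omega⟩) (basV K n k m)
          = if (k : ℕ) = 0 then cE0 K n q z u (by omega) • basV K n ⟨2 * n - 1, by omega⟩ (m + 1)
            else 0) ∧
      (∀ (i : Fin (2 * n)), i ≠ ⟨0, by omega⟩ → ∀ (k : Fin (2 * n)) (m : ℤ),
        Ψ (uE K n χ i) (basV K n k m)
          = if (k : ℕ) = (i : ℕ)
            then cEi K n χ q z u i • basV K n ⟨(i : ℕ) - 1, by omega⟩ m
            else 0) ∧
      (∀ (k : Fin (2 * n)) (m : ℤ),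
        Ψ (uF K n χ ⟨0, by omega⟩) (basV K n k m)
          = if (k : ℕ) = 2 * n - 1
            then (((u ⟨0, by omega⟩)⁻¹ : Kˣ) : K) • basV K n ⟨0, by omega⟩ (m - 1)
            else 0) ∧
      (∀ (i : Fin (2 * n)), i ≠ ⟨0, by omega⟩ → ∀ (k : Fin (2 * n)) (m : ℤ),
        Ψ (uF K n χ i) (basV K n k m)
          = if (k : ℕ) + 1 = (i : ℕ)
            then (((u i)⁻¹ : Kˣ) : K) • basV K n i m
            else 0) ∧
      (∀ (c : ℤ) (cc : Fin (2 * n) → ℤ) (k : Fin (2 * n)) (m : ℤ),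
        Ψ (uK K n χ (c • dr n + ∑ i, cc i • αr n i)) (basV K n k m)
          = ((q ^ (c * m) * ∏ i, (lamK K n χ z i (k : ℕ)) ^ (cc i) : Kˣ) : K)
              • basV K n k m) ∧
      (∀ (c : ℤ) (cc : Fin (2 * n) → ℤ) (k : Fin (2 * n)) (m : ℤ),
        Ψ (uL K n χ (c • dr n + ∑ i, cc i • αr n i)) (basV K n k m)
          = ((q ^ (-(c * m)) * ∏ i, (lamL K n χ q z i (k : ℕ)) ^ (cc i) : Kˣ) : K)
              • basV K n k m) := by
  have hc := cartan hχd hχ0 hχij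
  have hp := VR.prod_one hχ2 hδ
  have hp' := prod_one' hc hp
  have hL := lamL_eq hc z
  have hKs := lamK_step hp z
  have hLs := lamL_step (q := q) hp' z
  have h2nd := second hn hχd hχ0 z hL hKs hLs
  have hsh : ∀ i : Fin (2 * n), q ^ sh i = χ (dr n) (αr n i) ∧ q ^ sh i = χ (αr n i) (dr n) := by
    intro i
    rw [(hχdi i).1, (hχdi i).2]
    unfold sh
    split_ifs <;> simp
  let κ : Lam n → Fin (2 * n) → ℤ → Kˣ := kap (lamK K n χ z) q
  let μ : Lam n → Fin (2 * n) → ℤ → Kˣ := kap (lamL K n χ q z) q⁻¹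
  have hκ : ∀ a i m, κ a (prd i) (m + sh i) = χ a (αr n i) * κ a i m := by
    intro a i m
    exact kap_step _ _ (fun b => χ b (αr n i)) (fun b c => hχ1 b c _) i
      (fun j => hKs j i) (hsh i).1 a m
  have hμ : ∀ a i m, μ a (prd i) (m + sh i) = (χ (αr n i) a)⁻¹ * μ a i m := by
    intro a i m
    refine kap_step _ _ (fun b => (χ (αr n i) b)⁻¹) (fun b c => ?_) i
      (fun j => hLs j i) ?_ a m
    · rw [hχ2, mul_inv]
    · rw [← (hsh i).2, inv_zpow]
  let c : Fin (2 * n) → K := cU χ q z u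
  let d : Fin (2 * n) → K := fun i => (((u i)⁻¹ : Kˣ) : K)
  have hcd : ∀ i, c i * d i = (lamL K n χ q z i (prd i : Fin (2 * n)) : K)
      - (lamK K n χ z i (prd i : Fin (2 * n)) : K) := by
    intro i
    simp only [c, d, cU]
    rw [mul_right_comm, ← Units.val_mul, mul_inv_cancel]
    simp
  let gen : QGen (Lam n) (Fin (2 * n)) → Module.End K (VRep K n) := fun g =>
    match g with
    | QGen.Kg a => opD (κ a)
    | QGen.Lg a => opD (μ a)
    | QGen.Eg i => opE c i
    | QGen.Fg i => opF d i
  let φ : FA K n →ₐ[K] Module.End K (VRep K n) := FreeAlgebra.lift K gen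
  have fK' : ∀ a, φ (fK K n a) = opD (κ a) := fun a => FreeAlgebra.lift_ι_apply gen _
  have fL' : ∀ a, φ (fL K n a) = opD (μ a) := fun a => FreeAlgebra.lift_ι_apply gen _
  have fE' : ∀ a, φ (fE K n a) = opE c a := fun a => FreeAlgebra.lift_ι_apply gen _
  have fF' : ∀ a, φ (fF K n a) = opF d a := fun a => FreeAlgebra.lift_ι_apply gen _
  have fbE : ∀ a b X Y, φ (fbrE K n χ a b X Y) = br ((((χ b a)⁻¹ : Kˣ) : K)) (φ X) (φ Y) := by
    intro a b X Y
    simp only [fbrE, br, map_sub, map_mul, map_smul]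
  have fbF : ∀ a b X Y, φ (fbrF K n χ a b X Y) = br ((((χ a b)⁻¹ : Kˣ) : K)) (φ X) (φ Y) := by
    intro a b X Y
    simp only [fbrF, br, map_sub, map_mul, map_smul]
  have nE := opE_nil hn c
  have nF := opF_nil hn d
  have bz : ∀ (r : K) (X : Module.End K (VRep K n)), br r X (0 : Module.End K (VRep K n)) = 0 := by
    intro r X; simp [br]
  have hB : ∀ i j : Fin (2 * n), Bfm n i j = 0 → prd i ≠ j ∧ prd j ≠ i := by
    intro i j h
    constructor
    · rintro rfl; exact Bfm_prd hn i h
    · rintro rfl; rw [Bfm_comm] at h; exact Bfm_prd hn j h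
  have hrel : ∀ ⦃x y : FA K n⦄, NRel K n χ x y → φ x = φ y := by
    intro x y h
    cases h with
    | K0 =>
      rw [fK', map_one]
      apply op_ext
      intro k m
      simp [opD_bas, κ, kap_zero]
    | L0 =>
      rw [fL', map_one]
      apply op_ext
      intro k m
      simp [opD_bas, μ, kap_zero]
    | KK a b =>
      rw [map_mul, fK', fK', fK']
      apply op_ext
      intro k m
      simp [opD_bas, κ, kap_add, smul_smul, mul_comm]
    | LL a b =>
      rw [map_mul, fL', fL', fL']
      apply op_ext
      intro k m
      simp [opD_bas, μ, kap_add, smul_smul, mul_comm]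
    | KL a b =>
      rw [map_mul, map_mul, fL', fK']
      apply op_ext
      intro k m
      simp [opD_bas, smul_smul, mul_comm]
    | KE a i =>
      rw [map_smul, map_mul, map_mul, fK', fE']
      exact opDE _ _ _ _ (hκ a i)
    | KF a i =>
      rw [map_smul, map_mul, map_mul, fK', fF']
      exact opDF _ _ _ _ (hκ a i)
    | LE a i =>
      rw [map_smul, map_mul, map_mul, fL', fE']
      exact opDE _ _ _ _ (hμ a i)
    | LF a i =>
      rw [map_smul, map_mul, map_mul, fL', fF']
      have := opDF _ d _ _ (hμ a i)
      rwa [inv_inv] at this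
    | EFsame i =>
      rw [map_sub, map_mul, map_mul, map_add, map_neg, fL', fF', fE', fK']
      apply opEF_same hn
      · intro m
        simp only [κ, μ, kap_αr]
        exact (hcd i).symm
      · intro m
        simp only [κ, μ, kap_αr]
        rw [hcd i]; exact h2nd i
      · intro k m h1 h2
        simp only [κ, μ, kap_αr]
        rw [hL, wVec_eq]
        simp [h1, h2]
    | EFne i j h =>
      rw [map_sub, map_mul, map_mul, fF', fE', map_zero]
      exact opEF_ne _ _ _ _ h
    | SE1 i j h =>
      rw [fbE, fE', fE', map_zero, br, opE_mul c (hB i j h).2, opE_mul c (hB i j h).1]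
      simp
    | SE2 i j _ _ _ =>
      rw [fbE, fbE, fE', fE', map_zero]
      exact nil_se2 nE _ _ _ _
    | SE3 i j _ _ _ =>
      rw [fbE, fbE, fbE, fE', fE', map_zero, nil_se2 nE, bz]
    | SE4 i j k _ _ _ _ _ _ _ =>
      rw [fbE, fbE, fbE, fE', fE', fE', map_zero]
      exact nil_se4 nE _ _ _ _ _ _
    | SF1 i j h =>
      rw [fbF, fF', fF', map_zero, br, opF_mul d (hB i j h).1, opF_mul d (hB i j h).2]
      simp
    | SF2 i j _ _ _ =>
      rw [fbF, fbF, fF', fF', map_zero]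
      exact nil_se2 nF _ _ _ _
    | SF3 i j _ _ _ =>
      rw [fbF, fbF, fbF, fF', fF', map_zero, nil_se2 nF, bz]
    | SF4 i j k _ _ _ _ _ _ _ =>
      rw [fbF, fbF, fbF, fF', fF', fF', map_zero]
      exact nil_se4 nF _ _ _ _ _ _
  let Ψ : Unat K n χ →ₐ[K] Module.End K (VRep K n) := RingQuot.liftAlgHom K ⟨φ, hrel⟩
  have hΨ : ∀ x, Ψ (RingQuot.mkAlgHom K (NRel K n χ) x) = φ x := fun x =>
    RingQuot.liftAlgHom_mkAlgHom_apply K φ hrel x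
  have uK' : ∀ a, Ψ (uK K n χ a) = opD (κ a) := fun a => (hΨ _).trans (fK' a)
  have uL' : ∀ a, Ψ (uL K n χ a) = opD (μ a) := fun a => (hΨ _).trans (fL' a)
  have uE' : ∀ a, Ψ (uE K n χ a) = opE c a := fun a => (hΨ _).trans (fE' a)
  have uF' : ∀ a, Ψ (uF K n χ a) = opF d a := fun a => (hΨ _).trans (fF' a)
  refine ⟨Ψ, ?_, ?_, ?_, ?_, ?_, ?_, ?_, ?_, ?_, ?_⟩
  · intro k m
    rw [uK', opD_bas]; simp only [κ, kap_dr]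
  · intro k m
    rw [uL', opD_bas]; simp only [μ, kap_dr, inv_zpow']
  · intro i k m
    rw [uK', opD_bas]; simp only [κ, kap_αr]
  · intro i k m
    rw [uL', opD_bas]; simp only [μ, kap_αr]
  · intro k m
    rw [uE', opE_bas]
    have : c ⟨0, by omega⟩ = cE0 K n q z u (by omega) := cU_zero hn z u hL hp _ rfl _
    rw [this]
    have e1 : prd (⟨0, by omega⟩ : Fin (2 * n)) = ⟨2 * n - 1, by omega⟩ := rfl
    have e2 : sh (⟨0, by omega⟩ : Fin (2 * n)) = 1 := rfl
    rw [e1, e2]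
    simp only [Fin.ext_iff]
  · intro i hi k m
    have hi' : (i : ℕ) ≠ 0 := fun h => hi (Fin.ext h)
    rw [uE', opE_bas]
    have : c i = cEi K n χ q z u i := cU_pos hn z u hL i hi'
    rw [this]
    have e1 : prd i = ⟨(i : ℕ) - 1, by omega⟩ := by simp [prd, hi']
    have e2 : sh i = 0 := by simp [sh, hi']
    rw [e1, e2, add_zero]
    simp only [Fin.ext_iff]
  · intro k m
    rw [uF', opF_bas]
    have e1 : prd (⟨0, by omega⟩ : Fin (2 * n)) = ⟨2 * n - 1, by omega⟩ := rfl
    have e2 : sh (⟨0, by omega⟩ : Fin (2 * n)) = 1 := rfl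
    rw [e1, e2]
    simp only [Fin.ext_iff]
    rfl
  · intro i hi k m
    have hi' : (i : ℕ) ≠ 0 := fun h => hi (Fin.ext h)
    rw [uF', opF_bas]
    have e1 : k = prd i ↔ (k : ℕ) + 1 = i := by
      rw [Fin.ext_iff, prd_val, if_neg hi']; omega
    have e2 : sh i = 0 := by simp [sh, hi']
    rw [e2, sub_zero]
    simp only [e1]
    rfl
  · intro c cc k m
    rw [lam_coords, uK', opD_bas]
    rfl
  · intro c cc k m
    rw [lam_coords, uL', opD_bas]
    simp only [μ, kap, inv_zpow']
end

section
/- In U^♮_χ define B_{n−1} := E_n and, descending, B_i := ⌊E_{N−i−1},⌊B_{i+1},E_{i+1}⌋⌋ for i = n−2,…,1,0; define A_0 := E_0 and A_i := ⌊E_{N−i},⌊A_{i−1},E_i⌋⌋ for i = 1,…,n−1 (all q-brackets ⌊·,·⌋ computed with the degrees inherited from the letters E_j). Define scalars a_0 := 1 and a_i := a_{i−1}·χ(δ̂,α_{N−i})·χ(−α_i, Σ_{t=i+1}^{N−i−1}α_t)·χ(Σ_{t=i}^{N−i−1}α_t, −α_{N−i}) for i = 1,…,n−1, where δ̂ :=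 α_0 + Σ_{t=1}^{N−1}α_t ∈ ⊕ℤα_i. Set Z := Σ_{i=0}^{n−1} a_i ⌊A_i,B_i⌋ (a homogeneous element of degree δ̂). Then for every i ∈ I: Z·F_i − F_i·Z = 0 and Z·E_i − χ(α_i, δ̂)^{−1} E_i·Z = 0 in U^♮_χ. -/
namespace QA

structure Bic (K Λ : Type*) [Field K] [AddCommGroup Λ] where
  c : Λ → Λ → K
  ne : ∀ a b, c a b ≠ 0
  addl : ∀ a b d, c (a + b) d = c a d * c b d
  addr : ∀ a b d, c a (b + d) = c a b * c a d

section abs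
variable {K A Λ : Type*} [Field K] [Ring A] [Algebra K A] [AddCommGroup Λ] (β : Bic K Λ)

def hb (P Q : Λ × A) : Λ × A := (P.1 + Q.1, P.2 * Q.2 - β.c P.1 Q.1 • (Q.2 * P.2))

def Z0 (P Q : Λ × A) : Prop := P.2 * Q.2 = β.c P.1 Q.1 • (Q.2 * P.2)

def om (a b : Λ) : K := β.c a b * β.c b a

variable {β}

theorem om_comm (a b : Λ) : om β a b = om β b a := by simp [om, mul_comm]
theorem om_ne (a b : Λ) : om β a b ≠ 0 := mul_ne_zero (β.ne _ _) (β.ne _ _)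
theorem om_addl (a b d : Λ) : om β (a + b) d = om β a d * om β b d := by
  simp only [om, β.addl, β.addr]; ring
theorem om_addr (a b d : Λ) : om β a (b + d) = om β a b * om β a d := by
  simp only [om, β.addl, β.addr]; ring
theorem om_self (a : Λ) : om β a a = β.c a a * β.c a a := rfl

theorem c_eq {a b : Λ} {w : K} (h : om β a b = w) : β.c b a = w / β.c a b := by
  have := β.ne a b
  rw [← h, om]; field_simp

theorem Z0.symm {P Q : Λ × A} (h : Z0 β P Q) (ho : om β P.1 Q.1 = 1) : Z0 β Q P := by
  unfold Z0 at *
  rw [h, smul_smul, mul_comm, ← om, ho, one_smul]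

theorem Z0_iff {P Q : Λ × A} : Z0 β P Q ↔ (hb β P Q).2 = 0 := by
  simp [Z0, hb, sub_eq_zero]

/-- expansion into words -/
theorem hb_snd (P Q : Λ × A) : (hb β P Q).2 = P.2 * Q.2 - β.c P.1 Q.1 • (Q.2 * P.2) := rfl
theorem hb_fst (P Q : Λ × A) : (hb β P Q).1 = P.1 + Q.1 := rfl

theorem Z0.hb_left {P Q R : Λ × A} (h1 : Z0 β P R) (h2 : Z0 β Q R) : Z0 β (hb β P Q) R := by
  unfold Z0 at *
  have e1 := congrArg (fun z => z * Q.2) h1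
  have e2 := congrArg (fun z => Q.2 * z) h1
  have e3 := congrArg (fun z => P.2 * z) h2
  have e4 := congrArg (fun z => z * P.2) h2
  simp only [hb, β.addl, sub_mul, mul_sub, mul_smul_comm, smul_mul_assoc, mul_assoc] at *
  linear_combination (norm := module) e3 + (β.c Q.1 R.1) • e1 - (β.c P.1 Q.1) • e2
    - (β.c P.1 Q.1 * β.c P.1 R.1) • e4

theorem Z0.hb_right {P Q R : Λ × A} (h1 : Z0 β R P) (h2 : Z0 β R Q) : Z0 β R (hb β P Q) := by
  unfold Z0 at *
  have e1 := congrArg (fun z => z * Q.2) h1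
  have e2 := congrArg (fun z => Q.2 * z) h1
  have e3 := congrArg (fun z => P.2 * z) h2
  have e4 := congrArg (fun z => z * P.2) h2
  simp only [hb, β.addr, sub_mul, mul_sub, mul_smul_comm, smul_mul_assoc, mul_assoc] at *
  linear_combination (norm := module) e1 + (β.c R.1 P.1) • e3 - (β.c P.1 Q.1) • e4
    - (β.c P.1 Q.1 * β.c R.1 Q.1) • e2

theorem assoc {X Y Z : Λ × A} (h : Z0 β X Z) : hb β (hb β X Y) Z = hb β X (hb β Y Z) := by
  unfold Z0 at *
  have e1 := congrArg (fun z => z * Y.2) h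
  have e2 := congrArg (fun z => Y.2 * z) h
  refine Prod.ext (add_assoc _ _ _) ?_
  simp only [hb, β.addl, β.addr, sub_mul, mul_sub, mul_smul_comm, smul_mul_assoc, mul_assoc,
    smul_sub, smul_smul] at *
  linear_combination (norm := module) (β.c Y.1 Z.1) • e1 - (β.c X.1 Y.1) • e2

/-- commuting pair -/
structure Com (β : Bic K Λ) (P Q : Λ × A) : Prop where
  z : Z0 β P Q
  o : om β P.1 Q.1 = 1

theorem Com.symm {P Q : Λ × A} (h : Com β P Q) : Com β Q P :=
  ⟨h.z.symm h.o, by rw [om_comm]; exact h.o⟩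

theorem Com.hb_left {P Q R : Λ × A} (h1 : Com β P R) (h2 : Com β Q R) : Com β (hb β P Q) R :=
  ⟨h1.z.hb_left h2.z, by rw [hb_fst, om_addl, h1.o, h2.o, one_mul]⟩

theorem Com.hb_right {P Q R : Λ × A} (h1 : Com β R P) (h2 : Com β R Q) : Com β R (hb β P Q) :=
  ⟨h1.z.hb_right h2.z, by rw [hb_fst, om_addr, h1.o, h2.o, one_mul]⟩

/-- quadratic Serre relation -/
structure Ser (β : Bic K Λ) (P Q : Λ × A) : Prop where
  o : om β P.1 Q.1 = (β.c P.1 P.1)⁻¹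
  z : Z0 β P (hb β P Q)

theorem Ser.r {P Q : Λ × A} (h : Ser β P Q) : Z0 β (hb β Q P) P := by
  have ho := c_eq h.o
  have h2 := h.z
  rw [Z0_iff] at *
  have n1 := β.ne P.1 P.1
  have n2 := β.ne P.1 Q.1
  have n3 := β.ne Q.1 P.1
  suffices hs : (hb β (hb β Q P) P).2 = (β.c P.1 P.1 * β.c Q.1 P.1 ^ 2) • (hb β P (hb β P Q)).2 by
    rw [hs, h2, smul_zero]
  simp only [hb, β.addl, β.addr, sub_mul, mul_sub, mul_smul_comm, smul_mul_assoc, mul_assoc,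
    smul_sub, smul_smul, ho] at *
  match_scalars <;> field_simp

theorem Ser.of_r {P Q : Λ × A} (o : om β P.1 Q.1 = (β.c P.1 P.1)⁻¹)
    (h : Z0 β (hb β Q P) P) : Ser β P Q := by
  refine ⟨o, ?_⟩
  have ho := c_eq o
  rw [Z0_iff] at *
  have n1 := β.ne P.1 P.1
  have n2 := β.ne P.1 Q.1
  have n3 := β.ne Q.1 P.1
  have hs : (hb β (hb β Q P) P).2 = (β.c P.1 P.1 * β.c Q.1 P.1 ^ 2) • (hb β P (hb β P Q)).2 := by
    simp only [hb, β.addl, β.addr, sub_mul, mul_sub, mul_smul_comm, smul_mul_assoc, mul_assoc,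
      smul_sub, smul_smul, ho] at *
    match_scalars <;> field_simp
  rw [hs] at h
  exact (smul_eq_zero.mp h).resolve_left (mul_ne_zero n1 (pow_ne_zero _ n3))

theorem Ser.hb_right {e P Q : Λ × A} (hc : Com β P e) (hs : Ser β e Q) : Ser β e (hb β P Q) := by
  refine Ser.of_r ?_ ?_
  · rw [hb_fst, om_addr, om_comm e.1, hc.o, one_mul, hs.o]
  · rw [assoc hc.z]; exact hc.z.hb_left hs.r

theorem Ser.hb_left {e P Q : Λ × A} (hc : Com β P e) (hs : Ser β e Q) : Ser β e (hb β Q P) := by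
  refine ⟨?_, ?_⟩
  · rw [hb_fst, om_addr, om_comm e.1 P.1, hc.o, mul_one, hs.o]
  · rw [← assoc hc.symm.z]; exact hs.z.hb_right hc.symm.z

theorem interior {x a e : Λ × A} (h1 : Ser β a x) (h2 : Ser β a e) (hc : Com β x e)
    (hv : 1 + β.c a.1 a.1 ≠ 0) : Z0 β (hb β (hb β x a) e) a := by
  have S1 := h1.r
  have S2 := h2.z
  have C := hc.z
  have o1 := c_eq h1.o
  have o2 := c_eq h2.o
  rw [Z0_iff] at *
  have n1 := β.ne a.1 a.1
  have n2 := β.ne a.1 e.1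
  have n3 := β.ne a.1 x.1
  have k : (β.c a.1 e.1 * (1 + β.c a.1 a.1)) • (hb β (hb β (hb β x a) e) a).2 = 0 := by
    have s1 := congrArg (fun z => z * e.2) S1
    have s2 := congrArg (fun z => e.2 * z) S1
    have s3 := congrArg (fun z => x.2 * z) S2
    have s4 := congrArg (fun z => z * x.2) S2
    have c1 := congrArg (fun z => a.2 * (a.2 * z)) C
    have c2 := congrArg (fun z => a.2 * (z * a.2)) C
    have c3 := congrArg (fun z => z * (a.2 * a.2)) C
    simp only [hb, β.addl, β.addr, sub_mul, mul_sub, mul_smul_comm, smul_mul_assoc, mul_assoc,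
      smul_sub, smul_smul, mul_zero, zero_mul, o1, o2] at *
    generalize β.c a.1 a.1 = v at *
    generalize β.c a.1 e.1 = u at *
    generalize β.c x.1 e.1 = t at *
    generalize β.c a.1 x.1 = s' at *
    linear_combination (norm := skip) (-1 : K) • s3 + s1 - (t * u ^ 2) • s2
      + ((v⁻¹ / s') ^ 2 * t) • s4 + ((v⁻¹ / s') ^ 2) • c1
      - (u * (1 + v) * (v⁻¹ / s')) • c2 + (u ^ 2 * v) • c3
    match_scalars <;> field_simp <;> ring
  exact (smul_eq_zero.mp k).resolve_left (mul_ne_zero n2 hv)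

theorem interior' {x a e : Λ × A} (h1 : Ser β a x) (h2 : Ser β a e) (hc : Com β e x)
    (hv : 1 + β.c a.1 a.1 ≠ 0) : Z0 β a (hb β e (hb β a x)) := by
  have S1 := h1.z
  have S2 := h2.r
  have C := hc.z
  have o1 := c_eq ((om_comm _ _).trans h1.o)
  have o2 := c_eq ((om_comm _ _).trans h2.o)
  rw [Z0_iff] at *
  have n1 := β.ne a.1 a.1
  have n2 := β.ne e.1 a.1
  have n3 := β.ne x.1 a.1
  have k : (β.c e.1 a.1 * (1 + β.c a.1 a.1)) • (hb β a (hb β e (hb β a x))).2 = 0 := by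
    have s1 := congrArg (fun z => e.2 * z) S1
    have s2 := congrArg (fun z => z * e.2) S1
    have s3 := congrArg (fun z => z * x.2) S2
    have s4 := congrArg (fun z => x.2 * z) S2
    have c1 := congrArg (fun z => z * (a.2 * a.2)) C
    have c2 := congrArg (fun z => a.2 * (z * a.2)) C
    have c3 := congrArg (fun z => a.2 * (a.2 * z)) C
    simp only [hb, β.addl, β.addr, sub_mul, mul_sub, mul_smul_comm, smul_mul_assoc, mul_assoc,
      smul_sub, smul_smul, mul_zero, zero_mul, o1, o2] at *
    generalize β.c a.1 a.1 = v at *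
    generalize β.c e.1 a.1 = u at *
    generalize β.c e.1 x.1 = t at *
    generalize β.c x.1 a.1 = s' at *
    linear_combination (norm := skip) (-1 : K) • s3 + s1 - (t * u ^ 2) • s2
      + ((v⁻¹ / s') ^ 2 * t) • s4 + ((v⁻¹ / s') ^ 2) • c1
      - (u * (1 + v) * (v⁻¹ / s')) • c2 + (u ^ 2 * v) • c3
    match_scalars <;> field_simp <;> ring
  exact (smul_eq_zero.mp k).resolve_left (mul_ne_zero n2 hv)

end abs
end QA
namespace QA
section abs2
variable {K A Λ : Type*} [Field K] [Ring A] [Algebra K A] [AddCommGroup Λ] {β : Bic K Λ}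

theorem derL {p r : Λ × A} (f : Λ × A) (h : Z0 β p r) :
    (hb β f p).2 * r.2 + β.c f.1 p.1 • (p.2 * (hb β f r).2) =
    β.c p.1 r.1 • ((hb β f r).2 * p.2 + β.c f.1 r.1 • (r.2 * (hb β f p).2)) := by
  unfold Z0 at h
  have e1 := congrArg (fun z => f.2 * z) h
  have e2 := congrArg (fun z => z * f.2) h
  simp only [hb, sub_mul, mul_sub, mul_smul_comm, smul_mul_assoc, mul_assoc,
    smul_sub, smul_smul, smul_add] at *
  linear_combination (norm := module) e1 - (β.c f.1 p.1 * β.c f.1 r.1) • e2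

theorem derR {p r : Λ × A} (e : Λ × A) (h : Z0 β p r) :
    p.2 * (hb β r e).2 + β.c r.1 e.1 • ((hb β p e).2 * r.2) =
    β.c p.1 r.1 • (r.2 * (hb β p e).2 + β.c p.1 e.1 • ((hb β r e).2 * p.2)) := by
  unfold Z0 at h
  have e1 := congrArg (fun z => e.2 * z) h
  have e2 := congrArg (fun z => z * e.2) h
  simp only [hb, sub_mul, mul_sub, mul_smul_comm, smul_mul_assoc, mul_assoc,
    smul_sub, smul_smul, smul_add] at *
  linear_combination (norm := module) e2 - (β.c p.1 e.1 * β.c r.1 e.1) • e1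

theorem comR {X Y e : Λ × A} (h : Com β X Y) (h1 : Ser β e X) (h2 : Ser β e Y)
    (hv : 1 + β.c e.1 e.1 ≠ 0) : Com β (hb β X e) (hb β Y e) := by
  have n1 := β.ne e.1 e.1
  have n2 := β.ne e.1 X.1
  have n3 := β.ne e.1 Y.1
  have n4 := β.ne X.1 Y.1
  constructor
  · have R := derR e h.z
    have p0 := h1.r
    have r0 := h2.r
    have o1 := c_eq h1.o
    have o2 := c_eq h2.o
    unfold Z0 at *
    obtain ⟨p, hp⟩ : ∃ p, p = hb β X e := ⟨_, rfl⟩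
    obtain ⟨r, hr⟩ : ∃ r, r = hb β Y e := ⟨_, rfl⟩
    have dp : p.2 = X.2 * e.2 - β.c X.1 e.1 • (e.2 * X.2) := by rw [hp, hb_snd]
    have dr : r.2 = Y.2 * e.2 - β.c Y.1 e.1 • (e.2 * Y.2) := by rw [hr, hb_snd]
    have dp' : X.2 * e.2 = p.2 + β.c X.1 e.1 • (e.2 * X.2) := by rw [dp]; module
    have dr' : Y.2 * e.2 = r.2 + β.c Y.1 e.1 • (e.2 * Y.2) := by rw [dr]; module
    have hp1 : p.1 = X.1 + e.1 := by rw [hp, hb_fst]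
    have hr1 : r.1 = Y.1 + e.1 := by rw [hr, hb_fst]
    rw [← hp] at p0; rw [← hr] at r0; rw [← hp, ← hr] at R; rw [← hp, ← hr]
    have a1 := congrArg (fun z => z * e.2) R
    have a2 := congrArg (fun z => e.2 * z) R
    have b1 := congrArg (fun z => X.2 * z) r0
    have b2 := congrArg (fun z => z * X.2) r0
    have b3 := congrArg (fun z => Y.2 * z) p0
    have b4 := congrArg (fun z => z * Y.2) p0
    have d1 := congrArg (fun z => z * r.2) dp'
    have d2 := congrArg (fun z => z * p.2) dr'
    have d3 := congrArg (fun z => p.2 * z) dr'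
    have d4 := congrArg (fun z => r.2 * z) dp'
    suffices hs : (β.c Y.1 e.1 * (1 + β.c e.1 e.1)) • (p.2 * r.2 - β.c p.1 r.1 • (r.2 * p.2)) = 0 by
      have := (smul_eq_zero.mp hs).resolve_left (mul_ne_zero (β.ne _ _) hv)
      exact sub_eq_zero.mp this
    simp only [hp1, hr1, β.addl, β.addr, sub_mul, mul_sub, add_mul, mul_add, mul_smul_comm,
      smul_mul_assoc, mul_assoc, smul_sub, smul_smul, smul_add] at *
    clear dp dr dp' dr' hp hr hp1 hr1
    simp only [o1, o2] at *
    generalize β.c e.1 e.1 = v at *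
    generalize β.c X.1 Y.1 = s at *
    generalize β.c e.1 X.1 = t at *
    generalize β.c e.1 Y.1 = u at *
    linear_combination (norm := skip) a1 - ((v⁻¹ / u) * (v⁻¹ / t) * v) • a2
      - b1 + (s * (v⁻¹ / t) ^ 2) • b2 + s • b3 - ((v⁻¹ / u) ^ 2) • b4
      - ((v⁻¹ / u) * v) • d1 + (s * (v⁻¹ / t) * v) • d2 - (v⁻¹ / u) • d3 + (s * (v⁻¹ / t)) • d4
    match_scalars <;> field_simp <;> ring
  · rw [hb_fst, hb_fst, om_addl, om_addr, om_addr, h.o, h2.o, om_comm X.1, h1.o, om_self]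
    field_simp

end abs2
end QA
namespace QA
section abs3
variable {K A Λ : Type*} [Field K] [Ring A] [Algebra K A] [AddCommGroup Λ] {β : Bic K Λ}

theorem comL {X Y f : Λ × A} (h : Com β X Y) (h1 : Ser β f X) (h2 : Ser β f Y)
    (hv : 1 + β.c f.1 f.1 ≠ 0) : Com β (hb β f X) (hb β f Y) := by
  have n1 := β.ne f.1 f.1
  have n2 := β.ne f.1 X.1
  have n3 := β.ne f.1 Y.1
  have n4 := β.ne X.1 Y.1
  constructor
  · have R := derL f h.z
    have s0 := h1.z
    have u0 := h2.z
    have o1 := c_eq h1.o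
    have o2 := c_eq h2.o
    unfold Z0 at *
    obtain ⟨s, hs⟩ : ∃ s, s = hb β f X := ⟨_, rfl⟩
    obtain ⟨u, hu⟩ : ∃ u, u = hb β f Y := ⟨_, rfl⟩
    have ds : s.2 = f.2 * X.2 - β.c f.1 X.1 • (X.2 * f.2) := by rw [hs, hb_snd]
    have du : u.2 = f.2 * Y.2 - β.c f.1 Y.1 • (Y.2 * f.2) := by rw [hu, hb_snd]
    have ds' : f.2 * X.2 = s.2 + β.c f.1 X.1 • (X.2 * f.2) := by rw [ds]; module
    have du' : f.2 * Y.2 = u.2 + β.c f.1 Y.1 • (Y.2 * f.2) := by rw [du]; module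
    have hs1 : s.1 = f.1 + X.1 := by rw [hs, hb_fst]
    have hu1 : u.1 = f.1 + Y.1 := by rw [hu, hb_fst]
    rw [← hs] at s0; rw [← hu] at u0; rw [← hs, ← hu] at R; rw [← hs, ← hu]
    have a1 := congrArg (fun z => z * f.2) R
    have a2 := congrArg (fun z => f.2 * z) R
    have b1 := congrArg (fun z => z * Y.2) s0
    have b2 := congrArg (fun z => X.2 * z) u0
    have b3 := congrArg (fun z => z * X.2) u0
    have b4 := congrArg (fun z => Y.2 * z) s0
    have d1 := congrArg (fun z => s.2 * z) du'
    have d2 := congrArg (fun z => z * u.2) ds'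
    have d3 := congrArg (fun z => u.2 * z) ds'
    have d4 := congrArg (fun z => z * s.2) du'
    suffices hs : (β.c f.1 X.1 * (1 + β.c f.1 f.1)) • (s.2 * u.2 - β.c s.1 u.1 • (u.2 * s.2)) = 0 by
      have := (smul_eq_zero.mp hs).resolve_left (mul_ne_zero (β.ne _ _) hv)
      exact sub_eq_zero.mp this
    simp only [hs1, hu1, β.addl, β.addr, add_mul, mul_add, mul_smul_comm,
      smul_mul_assoc, mul_assoc, smul_sub, smul_smul, smul_add] at *
    clear ds du ds' du' hs hu hs1 hu1
    simp only [o1, o2] at *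
    generalize β.c f.1 f.1 = v at *
    generalize β.c X.1 Y.1 = k at *
    generalize β.c f.1 X.1 = t at *
    generalize β.c f.1 Y.1 = w at *
    linear_combination (norm := skip) a2 - (t * w * v) • a1
      - b1 - (t * v) • d1 - t • d2 - (t ^ 2) • b2 + k • b3 + (k * w * v) • d3 + (k * w) • d4
      + (k * w ^ 2) • b4
    match_scalars <;> field_simp <;> ring
  · rw [hb_fst, hb_fst, om_addl, om_addr, om_addr, h.o, h2.o, om_comm X.1, h1.o, om_self]
    field_simp

/-- The local `sl(2|2)^{(1)}`-type configuration. -/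
structure Quad (β : Bic K Λ) (X Y e f : Λ × A) (v : K) : Prop where
  XY : Com β X Y
  ef : Com β e f
  eX : Ser β e X
  eY : Ser β e Y
  fX : Ser β f X
  fY : Ser β f Y
  cee : β.c e.1 e.1 = v
  cff : β.c f.1 f.1 = v⁻¹
  hv : 1 + v ≠ 0

def rho (β : Bic K Λ) (X Y e f : Λ × A) : K :=
  (β.c f.1 X.1)⁻¹ * (β.c f.1 f.1)⁻¹ * β.c Y.1 e.1

def Wel (β : Bic K Λ) (X Y e f : Λ × A) : A :=
  (hb β X (hb β f (hb β Y e))).2 + rho β X Y e f • (hb β (hb β f (hb β X e)) Y).2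

theorem Quad.v0 {X Y e f : Λ × A} {v : K} (h : Quad β X Y e f v) : v ≠ 0 := by
  rw [← h.cee]; exact β.ne _ _

theorem Quad.W_e {X Y e f : Λ × A} {v : K} (h : Quad β X Y e f v) :
    Wel β X Y e f * e.2 = β.c (X.1 + (f.1 + (Y.1 + e.1))) e.1 • (e.2 * Wel β X Y e f) := by
  have hv1 : 1 + β.c e.1 e.1 ≠ 0 := by rw [h.cee]; exact h.hv
  have R := derL f (comR h.XY h.eX h.eY hv1).z
  have zA : Z0 β (hb β f (hb β X e)) e := h.ef.symm.z.hb_left h.eX.r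
  have zB : Z0 β (hb β f (hb β Y e)) e := h.ef.symm.z.hb_left h.eY.r
  have dp : X.2 * e.2 = (hb β X e).2 + β.c X.1 e.1 • (e.2 * X.2) := by rw [hb_snd]; module
  have dr : Y.2 * e.2 = (hb β Y e).2 + β.c Y.1 e.1 • (e.2 * Y.2) := by rw [hb_snd]; module
  unfold Wel rho
  have hp1 : (hb β X e).1 = X.1 + e.1 := rfl
  have hr1 : (hb β Y e).1 = Y.1 + e.1 := rfl
  generalize hb β X e = p at *
  generalize hb β Y e = r at *
  have hA1 : (hb β f p).1 = f.1 + (X.1 + e.1) := by rw [hb_fst, hp1]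
  have hB1 : (hb β f r).1 = f.1 + (Y.1 + e.1) := by rw [hb_fst, hr1]
  generalize hb β f p = P at *
  generalize hb β f r = B at *
  have x1 := congrArg (fun z => X.2 * z) zB
  have x2 := congrArg (fun z => z * B.2) dp
  have x3 := congrArg (fun z => B.2 * z) dp
  have x4 := congrArg (fun z => z * X.2) zB
  have x5 := congrArg (fun z => P.2 * z) dr
  have x6 := congrArg (fun z => z * Y.2) zA
  have x7 := congrArg (fun z => Y.2 * z) zA
  have x8 := congrArg (fun z => z * P.2) dr
  have o1 := c_eq h.eX.o
  have o2 := c_eq h.eY.o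
  have o3 := c_eq h.fX.o
  have o4 := c_eq h.fY.o
  have o5 := c_eq h.XY.o
  have o6 := c_eq h.ef.o
  have o7 := h.cee
  have o8 := h.cff
  have n0 := h.v0
  have n1 := β.ne X.1 Y.1
  have n2 := β.ne e.1 X.1
  have n3 := β.ne e.1 Y.1
  have n4 := β.ne f.1 X.1
  have n5 := β.ne f.1 Y.1
  have n6 := β.ne e.1 f.1
  clear zA zB h dp dr hv1
  simp only [hb_snd, hA1, hB1, hp1, hr1, β.addl, β.addr, add_mul, mul_add, sub_mul, mul_sub,
      mul_smul_comm, smul_mul_assoc, mul_assoc, smul_sub, smul_smul, smul_add] at *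
  clear hA1 hB1 hp1 hr1
  simp only [o7, o8] at *
  simp only [o1, o2, o3, o4, o5, o6] at *
  clear o1 o2 o3 o4 o5 o6 o7 o8
  generalize β.c X.1 Y.1 = k at *
  generalize β.c e.1 X.1 = t at *
  generalize β.c e.1 Y.1 = u at *
  generalize β.c f.1 X.1 = t' at *
  generalize β.c f.1 Y.1 = u' at *
  generalize β.c e.1 f.1 = w at *
  have hcB : ∃ cB, cB = (1 / w) * (v⁻¹ / u) * v := ⟨_, rfl⟩
  obtain ⟨cB, hcB⟩ := hcB
  obtain ⟨cA, hcA⟩ : ∃ cA, cA = (1 / w) * (v⁻¹ / t) * v := ⟨_, rfl⟩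
  obtain ⟨cXB, hcXB⟩ : ∃ c, c = ((v⁻¹)⁻¹ / t') * k * (v⁻¹ / t) := ⟨_, rfl⟩
  obtain ⟨cAY, hcAY⟩ : ∃ c, c = u' * k * u := ⟨_, rfl⟩
  obtain ⟨ρ, hρ⟩ : ∃ c, c = t'⁻¹ * (v⁻¹)⁻¹ * (v⁻¹ / u) := ⟨_, rfl⟩
  linear_combination (norm := skip) x1 + cB • x2 - cXB • x3 - (cXB * (v⁻¹ / t)) • x4
    + ρ • x5 + (ρ * (v⁻¹ / u)) • x6 - (ρ * cAY) • x7 - (ρ * cAY * cA) • x8 + ρ • R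
  subst hcB hcA hcXB hcAY hρ
  match_scalars <;> field_simp <;> ring

theorem Quad.W_f {X Y e f : Λ × A} {v : K} (h : Quad β X Y e f v) :
    Wel β X Y e f * f.2 = β.c (X.1 + (f.1 + (Y.1 + e.1))) f.1 • (f.2 * Wel β X Y e f) := by
  have n0 := h.v0
  have hv1 : 1 + β.c f.1 f.1 ≠ 0 := by
    rw [h.cff]; intro h0; apply h.hv; field_simp at h0; rw [add_comm]; simpa using h0
  have R := derR e (comL h.XY h.fX h.fY hv1).z
  have zA : Z0 β f (hb β (hb β f X) e) := h.fX.z.hb_right h.ef.symm.z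
  have zB : Z0 β f (hb β (hb β f Y) e) := h.fY.z.hb_right h.ef.symm.z
  have ds : f.2 * X.2 = (hb β f X).2 + β.c f.1 X.1 • (X.2 * f.2) := by rw [hb_snd]; module
  have du : f.2 * Y.2 = (hb β f Y).2 + β.c f.1 Y.1 • (Y.2 * f.2) := by rw [hb_snd]; module
  unfold Wel rho
  rw [← assoc h.ef.symm.z, ← assoc h.ef.symm.z]
  have hp1 : (hb β f X).1 = f.1 + X.1 := rfl
  have hr1 : (hb β f Y).1 = f.1 + Y.1 := rfl
  generalize hb β f X = s at *
  generalize hb β f Y = u at *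
  have hA1 : (hb β s e).1 = (f.1 + X.1) + e.1 := by rw [hb_fst, hp1]
  have hB1 : (hb β u e).1 = (f.1 + Y.1) + e.1 := by rw [hb_fst, hr1]
  generalize hb β s e = P at *
  generalize hb β u e = B at *
  have x1 := congrArg (fun z => z * B.2) ds
  have x2 := congrArg (fun z => X.2 * z) zB
  have x3 := congrArg (fun z => z * X.2) zB
  have x4 := congrArg (fun z => B.2 * z) ds
  have x5 := congrArg (fun z => z * Y.2) zA
  have x6 := congrArg (fun z => P.2 * z) du
  have x7 := congrArg (fun z => z * P.2) du
  have x8 := congrArg (fun z => Y.2 * z) zA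
  have o1 := c_eq h.eX.o
  have o2 := c_eq h.eY.o
  have o3 := c_eq h.fX.o
  have o4 := c_eq h.fY.o
  have o5 := c_eq h.XY.o
  have o6 := c_eq h.ef.o
  have o7 := h.cee
  have o8 := h.cff
  have n1 := β.ne X.1 Y.1
  have n2 := β.ne e.1 X.1
  have n3 := β.ne e.1 Y.1
  have n4 := β.ne f.1 X.1
  have n5 := β.ne f.1 Y.1
  have n6 := β.ne e.1 f.1
  clear zA zB h ds du hv1
  simp only [hb_snd, hA1, hB1, hp1, hr1, β.addl, β.addr, add_mul, mul_add, sub_mul, mul_sub,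
      mul_smul_comm, smul_mul_assoc, mul_assoc, smul_sub, smul_smul, smul_add] at *
  clear hA1 hB1 hp1 hr1
  simp only [o7, o8] at *
  simp only [o1, o2, o3, o4, o5, o6] at *
  clear o1 o2 o3 o4 o5 o6 o7 o8
  generalize β.c X.1 Y.1 = k at *
  generalize β.c e.1 X.1 = t at *
  generalize β.c e.1 Y.1 = u at *
  generalize β.c f.1 X.1 = t' at *
  generalize β.c f.1 Y.1 = u' at *
  generalize β.c e.1 f.1 = w at *
  obtain ⟨cB, hcB⟩ : ∃ cB, cB = v⁻¹ * u' * (1 / w) := ⟨_, rfl⟩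
  obtain ⟨cA, hcA⟩ : ∃ cA, cA = v⁻¹ * t' * (1 / w) := ⟨_, rfl⟩
  obtain ⟨cXB, hcXB⟩ : ∃ c, c = ((v⁻¹)⁻¹ / t') * k * (v⁻¹ / t) := ⟨_, rfl⟩
  obtain ⟨cAY, hcAY⟩ : ∃ c, c = u' * k * u := ⟨_, rfl⟩
  obtain ⟨ρ, hρ⟩ : ∃ c, c = t'⁻¹ * (v⁻¹)⁻¹ * (v⁻¹ / u) := ⟨_, rfl⟩
  obtain ⟨κ, hκ⟩ : ∃ c, c = (t' * cB)⁻¹ := ⟨_, rfl⟩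
  linear_combination (norm := skip) (-κ) • (x1 + t' • x2 - cXB • x3 - (cXB * cB) • x4
    + ρ • x5 + (ρ * cA) • x6 - (ρ * cAY) • x7 - (ρ * cAY * u') • x8 + R)
  subst hκ hcB hcA hcXB hcAY hρ
  match_scalars <;> field_simp <;> ring

end abs3
end QA
namespace QA
section abs4
variable {K A Λ : Type*} [Field K] [Ring A] [Algebra K A] [AddCommGroup Λ] {β : Bic K Λ}

def FC (F : A) (P : Λ × A) : Prop := P.2 * F = F * P.2

theorem FC.hb {F : A} {P Q : Λ × A} (h1 : FC F P) (h2 : FC F Q) : FC F (hb β P Q) := by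
  unfold FC at *
  rw [hb_snd, sub_mul, mul_sub, smul_mul_assoc, mul_smul_comm, mul_assoc, h2, ← mul_assoc, h1,
    mul_assoc, mul_assoc, h1, ← mul_assoc Q.2, h2, mul_assoc]

structure KL (β : Bic K Λ) (k l : A) (d : Λ) (P : Λ × A) : Prop where
  k : k * P.2 = (β.c P.1 d)⁻¹ • (P.2 * k)
  l : l * P.2 = β.c d P.1 • (P.2 * l)

theorem KL.hb {k l : A} {d : Λ} {P Q : Λ × A} (h1 : KL β k l d P) (h2 : KL β k l d Q) :
    KL β k l d (hb β P Q) := by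
  constructor
  · have e1 := congrArg (fun z => z * Q.2) h1.k
    have e2 := congrArg (fun z => P.2 * z) h2.k
    have e3 := congrArg (fun z => z * P.2) h2.k
    have e4 := congrArg (fun z => Q.2 * z) h1.k
    simp only [QA.hb, β.addl, mul_inv, sub_mul, mul_sub, mul_smul_comm, smul_mul_assoc, mul_assoc,
      smul_sub, smul_smul] at *
    generalize (β.c P.1 d)⁻¹ = a at *
    generalize (β.c Q.1 d)⁻¹ = b at *
    linear_combination (norm := module) e1 + a • e2 - (β.c P.1 Q.1) • (e3 + b • e4)
  · have e1 := congrArg (fun z => z * Q.2) h1.l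
    have e2 := congrArg (fun z => P.2 * z) h2.l
    have e3 := congrArg (fun z => z * P.2) h2.l
    have e4 := congrArg (fun z => Q.2 * z) h1.l
    simp only [QA.hb, β.addr, sub_mul, mul_sub, mul_smul_comm, smul_mul_assoc, mul_assoc,
      smul_sub, smul_smul] at *
    generalize (β.c d P.1) = a at *
    generalize (β.c d Q.1) = b at *
    linear_combination (norm := module) e1 + a • e2 - (β.c P.1 Q.1) • (e3 + b • e4)

/-- `[P, F] = κ p k`. -/
structure KR (F k : A) (d : Λ) (κ : K) (P p : Λ × A) : Prop where
  d : P.1 = d + p.1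
  e : P.2 * F - F * P.2 = κ • (p.2 * k)

theorem KR.base {F k l : A} {f p : Λ × A} (hf : f.2 * F - F * f.2 = -k + l)
    (hp : FC F p) (hk : KL β k l f.1 p) :
    KR F k f.1 (β.c f.1 p.1 - (β.c p.1 f.1)⁻¹) (hb β f p) p := by
  refine ⟨rfl, ?_⟩
  unfold FC at hp
  have e1 := congrArg (fun z => z * p.2) hf
  have e2 := congrArg (fun z => p.2 * z) hf
  have e3 := congrArg (fun z => z * f.2) hp
  have e4 := congrArg (fun z => f.2 * z) hp
  have h1 := hk.k
  have h2 := hk.l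
  simp only [hb_snd, sub_mul, mul_sub, add_mul, mul_add, neg_mul, mul_neg, mul_smul_comm,
    smul_mul_assoc, mul_assoc, smul_sub, smul_smul] at *
  linear_combination (norm := module) e1 - (β.c f.1 p.1) • e2 - (β.c f.1 p.1) • e3 + e4 - h1 + h2

theorem KR.right {F k l : A} {f P p e' : Λ × A} {κ : K} (h : KR F k f.1 κ P p)
    (he : FC F e') (hk : KL β k l f.1 e') (ho : om β f.1 e'.1 = 1) :
    KR F k f.1 (κ * β.c f.1 e'.1) (hb β P e') (hb β p e') := by
  refine ⟨by rw [hb_fst, hb_fst, h.d, add_assoc], ?_⟩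
  unfold FC at he
  have e1 := congrArg (fun z => z * e'.2) h.e
  have e2 := congrArg (fun z => e'.2 * z) h.e
  have e3 := congrArg (fun z => z * P.2) he
  have e4 := congrArg (fun z => P.2 * z) he
  have h1 := congrArg (fun z => p.2 * z) hk.k
  have o := c_eq ho
  have n := β.ne f.1 e'.1
  rw [o] at h1
  simp only [hb_snd, h.d, β.addl, sub_mul, mul_sub, mul_smul_comm,
    smul_mul_assoc, mul_assoc, smul_sub, smul_smul] at *
  generalize (β.c f.1 e'.1) = a at *
  generalize (β.c p.1 e'.1) = b at *
  linear_combination (norm := skip) e1 - (a * b) • e2 - (a * b) • e3 + e4 + κ • h1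
  match_scalars <;> field_simp <;> ring

theorem KR.left {F k l : A} {f P p f' : Λ × A} {κ : K} (h : KR F k f.1 κ P p)
    (he : FC F f') (hk : KL β k l f.1 f') (hz : Z0 β f' p) : FC F (hb β f' P) := by
  unfold FC Z0 at *
  have e1 := congrArg (fun z => z * f'.2) h.e
  have e2 := congrArg (fun z => f'.2 * z) h.e
  have e3 := congrArg (fun z => z * P.2) he
  have e4 := congrArg (fun z => P.2 * z) he
  have h1 := congrArg (fun z => p.2 * z) hk.k
  have h2 := congrArg (fun z => z * k) hz
  have n := β.ne f'.1 f.1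
  simp only [hb_snd, h.d, β.addr, sub_mul, mul_sub, mul_smul_comm,
    smul_mul_assoc, mul_assoc, smul_sub, smul_smul] at *
  generalize (β.c f'.1 f.1) = a at *
  generalize (β.c f'.1 p.1) = b at *
  linear_combination (norm := skip) e2 - (a * b) • e1 + e3 - (a * b) • e4 - (κ * a * b) • h1 + κ • h2
  match_scalars <;> field_simp <;> ring

/-- `[P, F] = κ s l`. -/
structure LR (F l : A) (d : Λ) (κ : K) (P s : Λ × A) : Prop where
  d : P.1 = s.1 + d
  e : P.2 * F - F * P.2 = κ • (s.2 * l)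

theorem LR.base {F k l : A} {X e : Λ × A} (hf : e.2 * F - F * e.2 = -k + l)
    (hX : FC F X) (hk : KL β k l e.1 X) :
    LR F l e.1 (1 - om β X.1 e.1) (hb β X e) X := by
  refine ⟨rfl, ?_⟩
  unfold FC at hX
  have e1 := congrArg (fun z => z * X.2) hf
  have e2 := congrArg (fun z => X.2 * z) hf
  have e3 := congrArg (fun z => z * e.2) hX
  have e4 := congrArg (fun z => e.2 * z) hX
  have h1 := hk.k
  have h2 := hk.l
  have n := β.ne X.1 e.1
  simp only [om, hb_snd, sub_mul, mul_sub, add_mul, mul_add, neg_mul, mul_neg, mul_smul_comm,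
    smul_mul_assoc, mul_assoc, smul_sub, smul_smul] at *
  generalize (β.c X.1 e.1) = a at *
  linear_combination (norm := skip) e2 - a • e1 + e3 - a • e4 + a • h1 - a • h2
  match_scalars <;> field_simp <;> ring

theorem LR.left {F k l : A} {e P s f : Λ × A} {κ : K} (h : LR F l e.1 κ P s)
    (he : FC F f) (hk : KL β k l e.1 f) (ho : om β e.1 f.1 = 1) :
    LR F l e.1 κ (hb β f P) (hb β f s) := by
  refine ⟨by rw [hb_fst, hb_fst, h.d, add_assoc], ?_⟩
  unfold FC at he
  have e1 := congrArg (fun z => z * f.2) h.e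
  have e2 := congrArg (fun z => f.2 * z) h.e
  have e3 := congrArg (fun z => z * P.2) he
  have e4 := congrArg (fun z => P.2 * z) he
  have h1 := congrArg (fun z => s.2 * z) hk.l
  have o := c_eq ho
  have n := β.ne e.1 f.1
  simp only [hb_snd, h.d, β.addr, sub_mul, mul_sub, mul_smul_comm,
    smul_mul_assoc, mul_assoc, smul_sub, smul_smul, o] at *
  generalize (β.c e.1 f.1) = a at *
  generalize (β.c f.1 s.1) = b at *
  linear_combination (norm := skip) e2 - (b / a) • e1 + e3 - (b / a) • e4 - (κ * b / a) • h1
  match_scalars <;> field_simp <;> ring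

theorem LR.right {F k l : A} {e P s e' : Λ × A} {κ : K} (h : LR F l e.1 κ P s)
    (he : FC F e') (hk : KL β k l e.1 e') (hz : Z0 β s e') : FC F (hb β P e') := by
  unfold FC Z0 at *
  have e1 := congrArg (fun z => z * e'.2) h.e
  have e2 := congrArg (fun z => e'.2 * z) h.e
  have e3 := congrArg (fun z => z * P.2) he
  have e4 := congrArg (fun z => P.2 * z) he
  have h1 := congrArg (fun z => s.2 * z) hk.l
  have h2 := congrArg (fun z => z * l) hz
  have n := β.ne e.1 e'.1
  simp only [hb_snd, h.d, β.addl, sub_mul, mul_sub, mul_smul_comm,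
    smul_mul_assoc, mul_assoc, smul_sub, smul_smul] at *
  generalize (β.c e.1 e'.1) = a at *
  generalize (β.c s.1 e'.1) = b at *
  linear_combination (norm := skip) e1 - (a * b) • e2 - (a * b) • e3 + e4 + κ • h1 + (κ * a) • h2
  match_scalars <;> field_simp <;> ring

theorem FC.of_LR {F l : A} {d : Λ} {P s : Λ × A} (h : LR F l d (0 : K) P s) : FC F P := by
  have := h.e
  rw [zero_smul] at this
  exact sub_eq_zero.mp this

theorem FC.of_KR {F k : A} {d : Λ} {P s : Λ × A} (h : KR F k d (0 : K) P s) : FC F P := by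
  have := h.e
  rw [zero_smul] at this
  exact sub_eq_zero.mp this

theorem Quad.W_Fe {X Y e f : Λ × A} {v : K} (h : Quad β X Y e f v) {F k l : A}
    (hf : e.2 * F - F * e.2 = -k + l) (fX : FC F X) (fY : FC F Y) (ff : FC F f)
    (kX : KL β k l e.1 X) (kY : KL β k l e.1 Y) (kf : KL β k l e.1 f) :
    Wel β X Y e f * F = F * Wel β X Y e f := by
  have R := congrArg (fun z => z * l) (derL f h.XY.z)
  have LA := ((LR.base hf fX kX).left ff kf h.ef.o).e
  have LB := ((LR.base hf fY kY).left ff kf h.ef.o).e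
  have oX : om β X.1 e.1 = v⁻¹ := by rw [om_comm, h.eX.o, h.cee]
  have oY : om β Y.1 e.1 = v⁻¹ := by rw [om_comm, h.eY.o, h.cee]
  rw [oX] at LA
  rw [oY] at LB
  have kX := kX.l
  have kY := kY.l
  unfold Wel rho
  unfold FC at *
  have hA1 : (hb β f (hb β X e)).1 = f.1 + (X.1 + e.1) := rfl
  have hB1 : (hb β f (hb β Y e)).1 = f.1 + (Y.1 + e.1) := rfl
  generalize hb β f (hb β X e) = P at *
  generalize hb β f (hb β Y e) = B at *
  generalize (hb β f X).2 = s at *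
  generalize (hb β f Y).2 = u at *
  have x1 := congrArg (fun z => z * X.2) LB
  have x2 := congrArg (fun z => X.2 * z) LB
  have x3 := congrArg (fun z => z * Y.2) LA
  have x4 := congrArg (fun z => Y.2 * z) LA
  have y1 := congrArg (fun z => z * B.2) fX
  have y2 := congrArg (fun z => B.2 * z) fX
  have y3 := congrArg (fun z => z * P.2) fY
  have y4 := congrArg (fun z => P.2 * z) fY
  have z1 := congrArg (fun z => u * z) kX
  have z2 := congrArg (fun z => s * z) kY
  have o1 := c_eq h.eX.o
  have o2 := c_eq h.eY.o
  have o3 := c_eq h.fX.o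
  have o4 := c_eq h.fY.o
  have o5 := c_eq h.XY.o
  have o6 := c_eq h.ef.o
  have o7 := h.cee
  have o8 := h.cff
  have n0 := h.v0
  have n1 := β.ne X.1 Y.1
  have n2 := β.ne e.1 X.1
  have n3 := β.ne e.1 Y.1
  have n4 := β.ne f.1 X.1
  have n5 := β.ne f.1 Y.1
  have n6 := β.ne e.1 f.1
  clear h hf ff kX kY kf LA LB oX oY
  simp only [hb_snd, hA1, hB1, β.addl, β.addr, add_mul, mul_add, sub_mul, mul_sub,
      mul_smul_comm, smul_mul_assoc, mul_assoc, smul_sub, smul_smul, smul_add] at *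
  clear hA1 hB1
  simp only [o7, o8] at *
  simp only [o1, o2, o3, o4, o5, o6] at *
  clear o1 o2 o3 o4 o5 o6 o7 o8
  generalize β.c X.1 Y.1 = k at *
  generalize β.c e.1 X.1 = t at *
  generalize β.c e.1 Y.1 = w at *
  generalize β.c f.1 X.1 = t' at *
  generalize β.c f.1 Y.1 = w' at *
  generalize β.c e.1 f.1 = w0 at *
  obtain ⟨cXB, hcXB⟩ : ∃ c, c = ((v⁻¹)⁻¹ / t') * k * (v⁻¹ / t) := ⟨_, rfl⟩
  obtain ⟨cAY, hcAY⟩ : ∃ c, c = w' * k * w := ⟨_, rfl⟩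
  obtain ⟨ρ, hρ⟩ : ∃ c, c = t'⁻¹ * (v⁻¹)⁻¹ * (v⁻¹ / w) := ⟨_, rfl⟩
  obtain ⟨μ, hμ⟩ : ∃ c, c = 1 - v⁻¹ := ⟨_, rfl⟩
  linear_combination (norm := skip) x2 - cXB • x1 + ρ • x3 - (ρ * cAY) • x4
    + y1 - cXB • y2 + ρ • y4 - (ρ * cAY) • y3
    - (cXB * μ) • z1 + (ρ * μ) • z2 + (μ / t') • R
  subst hcXB hcAY hρ hμ
  match_scalars <;> field_simp <;> ring

theorem Quad.W_Ff {X Y e f : Λ × A} {v : K} (h : Quad β X Y e f v) {F k l : A}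
    (hf : f.2 * F - F * f.2 = -k + l) (fX : FC F X) (fY : FC F Y) (fe : FC F e)
    (kX : KL β k l f.1 X) (kY : KL β k l f.1 Y) (ke : KL β k l f.1 e) :
    Wel β X Y e f * F = F * Wel β X Y e f := by
  have R := congrArg (fun z => z * k) (derR e h.XY.z)
  have LA := (KR.base hf (fX.hb (β := β) fe) (kX.hb ke)).e
  have LB := (KR.base hf (fY.hb (β := β) fe) (kY.hb ke)).e
  have kX := kX.k
  have kY := kY.k
  unfold Wel rho
  unfold FC at *
  have hA1 : (hb β f (hb β X e)).1 = f.1 + (X.1 + e.1) := rfl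
  have hB1 : (hb β f (hb β Y e)).1 = f.1 + (Y.1 + e.1) := rfl
  generalize hb β f (hb β X e) = P at *
  generalize hb β f (hb β Y e) = B at *
  rw [hb_fst] at LA LB
  generalize (hb β X e).2 = s at *
  generalize (hb β Y e).2 = u at *
  have x1 := congrArg (fun z => z * X.2) LB
  have x2 := congrArg (fun z => X.2 * z) LB
  have x3 := congrArg (fun z => z * Y.2) LA
  have x4 := congrArg (fun z => Y.2 * z) LA
  have y1 := congrArg (fun z => z * B.2) fX
  have y2 := congrArg (fun z => B.2 * z) fX
  have y3 := congrArg (fun z => z * P.2) fY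
  have y4 := congrArg (fun z => P.2 * z) fY
  have z1 := congrArg (fun z => u * z) kX
  have z2 := congrArg (fun z => s * z) kY
  have o1 := c_eq h.eX.o
  have o2 := c_eq h.eY.o
  have o3 := c_eq h.fX.o
  have o4 := c_eq h.fY.o
  have o5 := c_eq h.XY.o
  have o6 := c_eq h.ef.o
  have o7 := h.cee
  have o8 := h.cff
  have n0 := h.v0
  have n1 := β.ne X.1 Y.1
  have n2 := β.ne e.1 X.1
  have n3 := β.ne e.1 Y.1
  have n4 := β.ne f.1 X.1
  have n5 := β.ne f.1 Y.1
  have n6 := β.ne e.1 f.1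
  clear h hf fe kX kY ke LA LB
  simp only [hb_snd, hA1, hB1, β.addl, β.addr, add_mul, mul_add, sub_mul, mul_sub,
      mul_smul_comm, smul_mul_assoc, mul_assoc, smul_sub, smul_smul, smul_add] at *
  clear hA1 hB1
  simp only [o7, o8] at *
  simp only [o1, o2, o3, o4, o5, o6] at *
  clear o1 o2 o3 o4 o5 o6 o7 o8
  generalize β.c X.1 Y.1 = c0 at *
  generalize β.c e.1 X.1 = t at *
  generalize β.c e.1 Y.1 = w at *
  generalize β.c f.1 X.1 = t' at *
  generalize β.c f.1 Y.1 = w' at *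
  generalize β.c e.1 f.1 = w0 at *
  obtain ⟨cXB, hcXB⟩ : ∃ c, c = ((v⁻¹)⁻¹ / t') * c0 * (v⁻¹ / t) := ⟨_, rfl⟩
  obtain ⟨cAY, hcAY⟩ : ∃ c, c = w' * c0 * w := ⟨_, rfl⟩
  obtain ⟨ρ, hρ⟩ : ∃ c, c = t'⁻¹ * (v⁻¹)⁻¹ * (v⁻¹ / w) := ⟨_, rfl⟩
  obtain ⟨κA, hA⟩ : ∃ c, c = t' * (1 / w0) - ((v⁻¹)⁻¹ / t' * w0)⁻¹ := ⟨_, rfl⟩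
  obtain ⟨κB, hB⟩ : ∃ c, c = w' * (1 / w0) - ((v⁻¹)⁻¹ / w' * w0)⁻¹ := ⟨_, rfl⟩
  linear_combination (norm := skip) x2 - cXB • x1 + ρ • x3 - (ρ * cAY) • x4
    + y1 - cXB • y2 + ρ • y4 - (ρ * cAY) • y3
    - (cXB * κB) • z1 + (ρ * κA) • z2 + κB • R
  subst hcXB hcAY hρ hA hB
  match_scalars <;> field_simp <;> ring

/-- odd end nodes -/
theorem end_left {x B : Λ × A} (hx : x.2 * x.2 = 0) (hc : β.c x.1 x.1 = -1)
    (ho : om β x.1 B.1 = 1) : Z0 β (hb β x B) x := by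
  have o := c_eq ho
  have n := β.ne x.1 B.1
  unfold Z0
  have h1 := congrArg (fun z => z * B.2) hx
  have h2 := congrArg (fun z => B.2 * z) hx
  simp only [hb, β.addl, sub_mul, mul_sub, mul_smul_comm, smul_mul_assoc, mul_assoc,
      smul_sub, smul_smul, o, hc, mul_zero, zero_mul] at *
  rw [h1, h2]
  match_scalars <;> field_simp

theorem end_right {x P : Λ × A} (hx : x.2 * x.2 = 0) (hc : β.c x.1 x.1 = -1)
    (ho : om β x.1 P.1 = 1) : Z0 β (hb β P x) x := by
  have o := c_eq ho
  have n := β.ne x.1 P.1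
  unfold Z0
  have h1 := congrArg (fun z => z * P.2) hx
  have h2 := congrArg (fun z => P.2 * z) hx
  simp only [hb, β.addl, sub_mul, mul_sub, mul_smul_comm, smul_mul_assoc, mul_assoc,
      smul_sub, smul_smul, o, hc, mul_zero, zero_mul] at *
  rw [h1, h2]
  match_scalars <;> field_simp

end abs4
end QA
namespace QA
section abs5
variable {K A Λ : Type*} [Field K] [Ring A] [Algebra K A] [AddCommGroup Λ] {β : Bic K Λ}

structure Chain (β : Bic K Λ) (x0 : Λ × A) (e f : ℕ → Λ × A) (m : ℕ) (v : K) : Prop where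
  ee : ∀ i j, 1 ≤ i → i + 2 ≤ j → j ≤ m → Com β (e i) (e j)
  ff : ∀ i j, 1 ≤ i → i + 2 ≤ j → j ≤ m → Com β (f i) (f j)
  ef : ∀ i j, 1 ≤ i → i ≤ m → 1 ≤ j → j ≤ m → Com β (e i) (f j)
  xe : ∀ j, 2 ≤ j → j ≤ m → Com β x0 (e j)
  xf : ∀ j, 2 ≤ j → j ≤ m → Com β x0 (f j)
  see : ∀ i, 1 ≤ i → i + 1 ≤ m → Ser β (e i) (e (i + 1))
  see' : ∀ i, 1 ≤ i → i + 1 ≤ m → Ser β (e (i + 1)) (e i)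
  sff : ∀ i, 1 ≤ i → i + 1 ≤ m → Ser β (f i) (f (i + 1))
  sff' : ∀ i, 1 ≤ i → i + 1 ≤ m → Ser β (f (i + 1)) (f i)
  sex : 1 ≤ m → Ser β (e 1) x0
  sfx : 1 ≤ m → Ser β (f 1) x0
  cee : ∀ i, 1 ≤ i → i ≤ m → β.c (e i).1 (e i).1 = v
  cff : ∀ i, 1 ≤ i → i ≤ m → β.c (f i).1 (f i).1 = v⁻¹
  v0 : v ≠ 0
  hv : 1 + v ≠ 0

def xs (β : Bic K Λ) (x0 : Λ × A) (e f : ℕ → Λ × A) : ℕ → Λ × A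
  | 0 => x0
  | k + 1 => hb β (f (k + 1)) (hb β (xs β x0 e f k) (e (k + 1)))

variable {x0 : Λ × A} {e f : ℕ → Λ × A} {m : ℕ} {v : K}

theorem xs_ind {p : Λ × A → Prop} (hp : ∀ P Q, p P → p Q → p (hb β P Q)) {k₀ k : ℕ} (hk : k₀ ≤ k)
    (h0 : p (xs β x0 e f k₀)) (h1 : ∀ i, k₀ < i → i ≤ k → p (e i) ∧ p (f i)) :
    p (xs β x0 e f k) := by
  induction k, hk using Nat.le_induction with
  | base => exact h0
  | succ k hk ih =>
    have := h1 (k + 1) (by omega) le_rfl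
    exact hp _ _ this.2 (hp _ _ (ih fun i a b => h1 i a (by omega)) this.1)

theorem Chain.hv' (h : Chain β x0 e f m v) : 1 + v⁻¹ ≠ 0 := by
  have := h.v0
  intro h0; apply h.hv; field_simp at h0; rw [add_comm]; simpa using h0

theorem Chain.farE (h : Chain β x0 e f m v) {k j : ℕ} (hj : k + 2 ≤ j) (hm : j ≤ m) :
    Com β (xs β x0 e f k) (e j) :=
  xs_ind (p := fun P => Com β P (e j)) (fun _ _ a b => a.hb_left b) (Nat.zero_le _)
    (h.xe j (by omega) hm) fun i _ _ =>
      ⟨h.ee i j (by omega) (by omega) hm, (h.ef j i (by omega) hm (by omega) (by omega)).symm⟩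

theorem Chain.farF (h : Chain β x0 e f m v) {k j : ℕ} (hj : k + 2 ≤ j) (hm : j ≤ m) :
    Com β (xs β x0 e f k) (f j) :=
  xs_ind (p := fun P => Com β P (f j)) (fun _ _ a b => a.hb_left b) (Nat.zero_le _)
    (h.xf j (by omega) hm) fun i _ _ =>
      ⟨(h.ef i j (by omega) (by omega) (by omega) hm), h.ff i j (by omega) (by omega) hm⟩

theorem Chain.serE (h : Chain β x0 e f m v) {k : ℕ} (hk : k + 1 ≤ m) :
    Ser β (e (k + 1)) (xs β x0 e f k) := by
  cases k with
  | zero => exact h.sex (by omega)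
  | succ k =>
    exact Ser.hb_right (h.ef _ _ (by omega) hk (by omega) (by omega)).symm
      (Ser.hb_right (h.farE (by omega) hk) (h.see' _ (by omega) hk))

theorem Chain.serF (h : Chain β x0 e f m v) {k : ℕ} (hk : k + 1 ≤ m) :
    Ser β (f (k + 1)) (xs β x0 e f k) := by
  cases k with
  | zero => exact h.sfx (by omega)
  | succ k =>
    exact Ser.hb_left ((h.farF (by omega) hk).hb_left
      (h.ef _ _ (by omega) (by omega) (by omega) hk)) (h.sff' _ (by omega) hk)

theorem Chain.nearE0 (h : Chain β x0 e f m v) {i : ℕ} (hi : i + 2 ≤ m) :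
    Com β (xs β x0 e f (i + 2)) (e (i + 1)) := by
  have c1 := h.ef (i + 1) (i + 2) (by omega) (by omega) (by omega) (by omega)
  have c2 := h.ef (i + 1) (i + 1) (by omega) (by omega) (by omega) (by omega)
  have c3 := h.ef (i + 2) (i + 1) (by omega) (by omega) (by omega) (by omega)
  have s1 := h.serE (k := i) (by omega)
  have s2 := h.see (i + 1) (by omega) (by omega)
  have cv := h.cee (i + 1) (by omega) (by omega)
  have n := h.v0
  constructor
  · refine c1.symm.z.hb_left ?_
    show Z0 β (hb β (hb β (f (i + 1)) (hb β (xs β x0 e f i) (e (i + 1)))) (e (i + 2))) _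
    rw [assoc c3.symm.z]
    refine c2.symm.z.hb_left (interior s1 s2 (h.farE (by omega) hi) ?_)
    rw [cv]; exact h.hv
  · simp only [xs, hb_fst, om_addl]
    rw [om_comm (f _).1, c1.o, om_comm (f _).1, c2.o, om_comm (xs _ _ _ _ _).1, s1.o,
      om_comm (e (i + 1 + 1)).1, s2.o, om_self, cv]
    field_simp

theorem Chain.nearF0 (h : Chain β x0 e f m v) {i : ℕ} (hi : i + 2 ≤ m) :
    Com β (xs β x0 e f (i + 2)) (f (i + 1)) := by
  have c1 := h.ef (i + 2) (i + 1) (by omega) (by omega) (by omega) (by omega)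
  have c2 := h.ef (i + 1) (i + 1) (by omega) (by omega) (by omega) (by omega)
  have c3 := h.ef (i + 1) (i + 2) (by omega) (by omega) (by omega) (by omega)
  have c4 := h.ef (i + 2) (i + 2) (by omega) (by omega) (by omega) (by omega)
  have s1 := h.serF (k := i) (by omega)
  have s2 := h.sff (i + 1) (by omega) (by omega)
  have cv := h.cff (i + 1) (by omega) (by omega)
  have n := h.v0
  refine Com.symm ?_
  constructor
  · show Z0 β _ (hb β (f (i + 2)) (hb β (hb β (f (i + 1)) (hb β (xs β x0 e f i) (e (i + 1))))
      (e (i + 2))))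
    rw [← assoc c4.symm.z, ← assoc c2.symm.z, ← assoc c3.symm.z]
    refine Z0.hb_right (Z0.hb_right (interior' s1 s2 (h.farF (by omega) hi).symm ?_)
      c2.symm.z) c1.symm.z
    rw [cv]; exact h.hv'
  · simp only [xs, hb_fst, om_addr]
    rw [om_comm (f _).1 (e (i + 1 + 1)).1, c1.o, om_comm (f _).1 (e (i + 1)).1, c2.o, s1.o, s2.o,
      om_self, cv]
    field_simp

theorem Chain.nearE (h : Chain β x0 e f m v) {j k : ℕ} (hj : 1 ≤ j) (hk : j < k) (hm : k ≤ m) :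
    Com β (xs β x0 e f k) (e j) := by
  obtain ⟨i, rfl⟩ : ∃ i, j = i + 1 := ⟨j - 1, by omega⟩
  exact xs_ind (p := fun P => Com β P (e (i + 1))) (k₀ := i + 2) (fun _ _ a b => a.hb_left b)
    (by omega) (h.nearE0 (by omega)) fun t _ _ =>
      ⟨(h.ee (i + 1) t (by omega) (by omega) (by omega)).symm,
        (h.ef (i + 1) t (by omega) (by omega) (by omega) (by omega)).symm⟩

theorem Chain.nearF (h : Chain β x0 e f m v) {j k : ℕ} (hj : 1 ≤ j) (hk : j < k) (hm : k ≤ m) :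
    Com β (xs β x0 e f k) (f j) := by
  obtain ⟨i, rfl⟩ : ∃ i, j = i + 1 := ⟨j - 1, by omega⟩
  exact xs_ind (p := fun P => Com β P (f (i + 1))) (k₀ := i + 2) (fun _ _ a b => a.hb_left b)
    (by omega) (h.nearF0 (by omega)) fun t _ _ =>
      ⟨(h.ef t (i + 1) (by omega) (by omega) (by omega) (by omega)),
        (h.ff (i + 1) t (by omega) (by omega) (by omega)).symm⟩

/-- `K,L`-relations for all letters -/
structure KLc (β : Bic K Λ) (k l : A) (d : Λ) (x0 : Λ × A) (e f : ℕ → Λ × A) (m : ℕ) : Prop where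
  x : KL β k l d x0
  e : ∀ i, 1 ≤ i → i ≤ m → KL β k l d (e i)
  f : ∀ i, 1 ≤ i → i ≤ m → KL β k l d (f i)

theorem KLc.xs {k l : A} {d : Λ} (h : KLc β k l d x0 e f m) {t : ℕ} (ht : t ≤ m) :
    KL β k l d (xs β x0 e f t) :=
  xs_ind (p := fun P => KL β k l d P) (fun _ _ a b => a.hb b) (Nat.zero_le _)
    h.x fun i _ _ => ⟨h.e i (by omega) (by omega), h.f i (by omega) (by omega)⟩

theorem FCxs {F : A} {t : ℕ} (hx : FC F x0) (he : ∀ i, 1 ≤ i → i ≤ t → FC F (e i))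
    (hf : ∀ i, 1 ≤ i → i ≤ t → FC F (f i)) : FC F (xs β x0 e f t) :=
  xs_ind (p := fun P => FC F P) (fun _ _ a b => a.hb b) (Nat.zero_le _)
    hx fun i _ _ => ⟨he i (by omega) (by omega), hf i (by omega) (by omega)⟩

theorem Chain.Fe (h : Chain β x0 e f m v) {F k l : A} {j : ℕ} (hj : 1 ≤ j) (hjm : j ≤ m)
    (hF : (e j).2 * F - F * (e j).2 = -k + l) (hk : KLc β k l (e j).1 x0 e f m)
    (hx : FC F x0) (he : ∀ i, 1 ≤ i → i ≤ m → i ≠ j → FC F (e i))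
    (hf : ∀ i, 1 ≤ i → i ≤ m → FC F (f i)) {t : ℕ} (ht : t ≤ m) (htj : t ≠ j) :
    FC F (xs β x0 e f t) := by
  rcases lt_or_gt_of_ne htj with h1 | h1
  · exact FCxs hx (fun i _ _ => he i (by omega) (by omega) (by omega))
      (fun i _ _ => hf i (by omega) (by omega))
  · obtain ⟨i, rfl⟩ : ∃ i, j = i + 1 := ⟨j - 1, by omega⟩
    have fi : FC F (xs β x0 e f i) := FCxs hx (fun i _ _ => he i (by omega) (by omega) (by omega))
      (fun i _ _ => hf i (by omega) (by omega))
    have b : FC F (xs β x0 e f (i + 2)) := by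
      refine FC.hb (hf _ (by omega) (by omega)) ?_
      have L := (LR.base hF fi (hk.xs (by omega))).left (hf (i + 1) (by omega) (by omega))
        (hk.f _ (by omega) (by omega)) (h.ef (i + 1) (i + 1) (by omega) (by omega)
        (by omega) (by omega)).o
      exact L.right (he (i + 2) (by omega) (by omega) (by omega)) (hk.e _ (by omega) (by omega))
        ((h.ef (i + 2) (i + 1) (by omega) (by omega) (by omega) (by omega)).symm.z.hb_left
          (h.farE (by omega) (by omega)).z)
    exact xs_ind (p := fun P => FC F P) (fun _ _ a b => a.hb b) (k₀ := i + 2) (by omega)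
      b fun t _ _ => ⟨he t (by omega) (by omega) (by omega), hf t (by omega) (by omega)⟩

theorem Chain.Ff (h : Chain β x0 e f m v) {F k l : A} {j : ℕ} (hj : 1 ≤ j) (hjm : j ≤ m)
    (hF : (f j).2 * F - F * (f j).2 = -k + l) (hk : KLc β k l (f j).1 x0 e f m)
    (hx : FC F x0) (hf : ∀ i, 1 ≤ i → i ≤ m → i ≠ j → FC F (f i))
    (he : ∀ i, 1 ≤ i → i ≤ m → FC F (e i)) {t : ℕ} (ht : t ≤ m) (htj : t ≠ j) :
    FC F (xs β x0 e f t) := by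
  rcases lt_or_gt_of_ne htj with h1 | h1
  · exact FCxs hx (fun i _ _ => he i (by omega) (by omega))
      (fun i _ _ => hf i (by omega) (by omega) (by omega))
  · obtain ⟨i, rfl⟩ : ∃ i, j = i + 1 := ⟨j - 1, by omega⟩
    have fi : FC F (xs β x0 e f i) := FCxs hx (fun i _ _ => he i (by omega) (by omega))
      (fun i _ _ => hf i (by omega) (by omega) (by omega))
    have b : FC F (xs β x0 e f (i + 2)) := by
      have L := (KR.base hF (FC.hb (β := β) fi (he (i + 1) (by omega) (by omega)))
        ((hk.xs (by omega)).hb (hk.e _ (by omega) (by omega)))).right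
        (he (i + 2) (by omega) (by omega)) (hk.e _ (by omega) (by omega))
        ((h.ef (i + 2) (i + 1) (by omega) (by omega) (by omega) (by omega)).symm.o)
      exact L.left (hf (i + 2) (by omega) (by omega) (by omega)) (hk.f _ (by omega) (by omega))
        (((h.farF (by omega) (by omega)).symm.z.hb_right
          (h.ef (i + 1) (i + 2) (by omega) (by omega) (by omega) (by omega)).symm.z).hb_right
          (h.ef (i + 2) (i + 2) (by omega) (by omega) (by omega) (by omega)).symm.z)
    exact xs_ind (p := fun P => FC F P) (fun _ _ a b => a.hb b) (k₀ := i + 2) (by omega)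
      b fun t _ _ => ⟨he t (by omega) (by omega), hf t (by omega) (by omega) (by omega)⟩

theorem Chain.Fx (h : Chain β x0 e f m v) {F k l : A}
    (hF : x0.2 * F - F * x0.2 = -k + l) (hk : KLc β k l x0.1 x0 e f m)
    (hf : ∀ i, 1 ≤ i → i ≤ m → FC F (f i))
    (he : ∀ i, 1 ≤ i → i ≤ m → FC F (e i)) {t : ℕ} (ht : t ≤ m) (ht0 : t ≠ 0) :
    FC F (xs β x0 e f t) := by
  have b : FC F (xs β x0 e f 1) := by
    have L := KR.base hF (he 1 le_rfl (by omega)) (hk.e 1 le_rfl (by omega))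
    exact L.left (hf 1 le_rfl (by omega)) (hk.f 1 le_rfl (by omega))
      (h.ef 1 1 le_rfl (by omega) le_rfl (by omega)).symm.z
  exact xs_ind (p := fun P => FC F P) (fun _ _ a b => a.hb b) (k₀ := 1) (by omega)
      b fun t _ _ => ⟨he t (by omega) (by omega), hf t (by omega) (by omega)⟩

end abs5
end QA
namespace QA
section abs6
variable {K A Λ : Type*} [Field K] [Ring A] [Algebra K A] [AddCommGroup Λ] {β : Bic K Λ}

theorem oddSerre {x e f : Λ × A} {w : K} (hx : x.2 * x.2 = 0) (hc : β.c x.1 x.1 = -1)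
    (oe : om β x.1 e.1 = w) (of : om β x.1 f.1 = w⁻¹) (oef : om β e.1 f.1 = 1)
    (h : Z0 β (hb β x e) (hb β x f)) :
    Z0 β (hb β f (hb β x e)) x := by
  have o1 := c_eq oe
  have o2 := c_eq of
  have o3 := c_eq oef
  have n1 := β.ne x.1 e.1
  have n2 := β.ne x.1 f.1
  have n3 := β.ne e.1 f.1
  have n4 : w ≠ 0 := by rw [← oe]; exact om_ne _ _
  unfold Z0 at *
  have h1 := congrArg (fun z => f.2 * (e.2 * z)) hx
  have h2 := congrArg (fun z => e.2 * (f.2 * z)) hx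
  have h3 := congrArg (fun z => e.2 * (z * f.2)) hx
  have h4 := congrArg (fun z => f.2 * (z * e.2)) hx
  have h5 := congrArg (fun z => z * (e.2 * f.2)) hx
  have h6 := congrArg (fun z => z * (f.2 * e.2)) hx
  simp only [hb, β.addl, β.addr, sub_mul, mul_sub, mul_smul_comm, smul_mul_assoc, mul_assoc,
      smul_sub, smul_smul, o1, o2, o3, hc, mul_zero, zero_mul] at *
  simp only [h1, h2, h3, h4, h5, h6, smul_zero] at *
  generalize β.c x.1 e.1 = a at *
  generalize β.c x.1 f.1 = b at *
  generalize β.c e.1 f.1 = t at *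
  linear_combination (norm := skip) (t⁻¹ * (w⁻¹ / b) ^ 2 * w) • h
  match_scalars <;> field_simp <;> ring

structure Sys (β : Bic K Λ) (E : ℕ → Λ × A) (F k l : ℕ → A) (n : ℕ) (v : K) : Prop where
  far : ∀ i j, i + 2 ≤ j → j < 2 * n → (i ≠ 0 ∨ j ≠ 2 * n - 1) → Com β (E i) (E j)
  ser : ∀ i j, i < 2 * n → j < 2 * n → i ≠ 0 → i ≠ n →
    (j = i + 1 ∨ i = j + 1 ∨ (j = 0 ∧ i = 2 * n - 1)) → Ser β (E i) (E j)
  cp : ∀ i, 1 ≤ i → i < n → β.c (E i).1 (E i).1 = v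
  cm : ∀ i, n < i → i < 2 * n → β.c (E i).1 (E i).1 = v⁻¹
  c0 : β.c (E 0).1 (E 0).1 = -1
  cn : β.c (E n).1 (E n).1 = -1
  s0 : (E 0).2 * (E 0).2 = 0
  sn : (E n).2 * (E n).2 = 0
  q0 : Z0 β (hb β (E 0) (E 1)) (hb β (E 0) (E (2 * n - 1)))
  qn : Z0 β (hb β (E n) (E (n - 1))) (hb β (E n) (E (n + 1)))
  v0 : v ≠ 0
  hv : 1 + v ≠ 0
  ef : ∀ i, i < 2 * n → (E i).2 * F i - F i * (E i).2 = -k i + l i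
  fc : ∀ i j, i < 2 * n → j < 2 * n → i ≠ j → FC (F i) (E j)
  kl : ∀ i j, i < 2 * n → j < 2 * n → KL β (k i) (l i) (E i).1 (E j)

variable {E : ℕ → Λ × A} {F k l : ℕ → A} {n : ℕ} {v : K}

def As (β : Bic K Λ) (E : ℕ → Λ × A) (n : ℕ) (i : ℕ) : Λ × A :=
  xs β (E 0) (fun k => E k) (fun k => E (2 * n - k)) i
def Cs (β : Bic K Λ) (E : ℕ → Λ × A) (n : ℕ) (i : ℕ) : Λ × A :=
  xs β (E n) (fun k => E (n - k)) (fun k => E (n + k)) i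

theorem Sys.chA (h : Sys β E F k l n v) (hn : 2 ≤ n) :
    Chain β (E 0) (fun k => E k) (fun k => E (2 * n - k)) (n - 1) v where
  ee i j _ _ _ := h.far i j (by omega) (by omega) (by omega)
  ff i j _ _ _ := (h.far (2 * n - j) (2 * n - i) (by omega) (by omega) (by omega)).symm
  ef i j _ _ _ _ := h.far _ _ (by omega) (by omega) (by omega)
  xe j _ _ := h.far _ _ (by omega) (by omega) (by omega)
  xf j _ _ := h.far _ _ (by omega) (by omega) (by omega)
  see i _ _ := h.ser _ _ (by omega) (by omega) (by omega) (by omega) (by omega)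
  see' i _ _ := h.ser _ _ (by omega) (by omega) (by omega) (by omega) (by omega)
  sff i _ _ := h.ser _ _ (by omega) (by omega) (by omega) (by omega) (by omega)
  sff' i _ _ := h.ser _ _ (by omega) (by omega) (by omega) (by omega) (by omega)
  sex _ := h.ser _ _ (by omega) (by omega) (by omega) (by omega) (by omega)
  sfx _ := h.ser _ _ (by omega) (by omega) (by omega) (by omega) (by omega)
  cee i _ _ := h.cp _ (by omega) (by omega)
  cff i _ _ := h.cm _ (by omega) (by omega)
  v0 := h.v0
  hv := h.hv

theorem Sys.chC (h : Sys β E F k l n v) (hn : 2 ≤ n) :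
    Chain β (E n) (fun k => E (n - k)) (fun k => E (n + k)) (n - 1) v where
  ee i j _ _ _ := (h.far _ _ (by omega) (by omega) (by omega)).symm
  ff i j _ _ _ := (h.far _ _ (by omega) (by omega) (by omega))
  ef i j _ _ _ _ := h.far _ _ (by omega) (by omega) (by omega)
  xe j _ _ := (h.far _ _ (by omega) (by omega) (by omega)).symm
  xf j _ _ := h.far _ _ (by omega) (by omega) (by omega)
  see i _ _ := h.ser _ _ (by omega) (by omega) (by omega) (by omega) (by omega)
  see' i _ _ := h.ser _ _ (by omega) (by omega) (by omega) (by omega) (by omega)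
  sff i _ _ := h.ser _ _ (by omega) (by omega) (by omega) (by omega) (by omega)
  sff' i _ _ := h.ser _ _ (by omega) (by omega) (by omega) (by omega) (by omega)
  sex _ := h.ser _ _ (by omega) (by omega) (by omega) (by omega) (by omega)
  sfx _ := h.ser _ _ (by omega) (by omega) (by omega) (by omega) (by omega)
  cee i _ _ := h.cp _ (by omega) (by omega)
  cff i _ _ := h.cm _ (by omega) (by omega)
  v0 := h.v0
  hv := h.hv

theorem Sys.klA (h : Sys β E F k l n v) (hn : 2 ≤ n) {i : ℕ} (hi : i < 2 * n) :
    KLc β (k i) (l i) (E i).1 (E 0) (fun k => E k) (fun k => E (2 * n - k)) (n - 1) where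
  x := h.kl _ _ hi (by omega)
  e j _ _ := h.kl _ _ hi (by omega)
  f j _ _ := h.kl _ _ hi (by omega)

theorem Sys.klC (h : Sys β E F k l n v) (hn : 2 ≤ n) {i : ℕ} (hi : i < 2 * n) :
    KLc β (k i) (l i) (E i).1 (E n) (fun k => E (n - k)) (fun k => E (n + k)) (n - 1) where
  x := h.kl _ _ hi (by omega)
  e j _ _ := h.kl _ _ hi (by omega)
  f j _ _ := h.kl _ _ hi (by omega)

/-- anything with all letters -/
theorem As_ind {p : Λ × A → Prop} (hp : ∀ P Q, p P → p Q → p (hb β P Q)) {i : ℕ}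
    (h0 : p (E 0)) (h1 : ∀ t, 1 ≤ t → t ≤ i → p (E t) ∧ p (E (2 * n - t))) :
    p (As β E n i) :=
  xs_ind hp (Nat.zero_le _) h0 fun t a b => h1 t a b

theorem Cs_ind {p : Λ × A → Prop} (hp : ∀ P Q, p P → p Q → p (hb β P Q)) {i : ℕ}
    (h0 : p (E n)) (h1 : ∀ t, 1 ≤ t → t ≤ i → p (E (n - t)) ∧ p (E (n + t))) :
    p (Cs β E n i) :=
  xs_ind hp (Nat.zero_le _) h0 fun t a b => h1 t a b

theorem Sys.farA (h : Sys β E F k l n v) {i j : ℕ} (hj : i + 2 ≤ j)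
    (hj2 : j + i + 2 ≤ 2 * n) : Com β (As β E n i) (E j) := by
  refine As_ind (p := fun P => Com β P (E j)) (fun _ _ a b => a.hb_left b)
    (h.far _ _ (by omega) (by omega) (by omega)) fun t _ _ =>
    ⟨h.far _ _ (by omega) (by omega) (by omega),
      (h.far _ _ (by omega) (by omega) (by omega)).symm⟩

theorem Sys.farAC (h : Sys β E F k l n v) {i j : ℕ} (hj : i + j + 2 ≤ n) :
    Com β (As β E n i) (Cs β E n j) :=
  Cs_ind (p := fun P => Com β (As β E n i) P) (fun _ _ a b => a.hb_right b)
    (h.farA (by omega) (by omega)) fun t _ _ =>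
    ⟨h.farA (by omega) (by omega), h.farA (by omega) (by omega)⟩

theorem Sys.farC (h : Sys β E F k l n v) {j : ℕ} (hj : j + 2 ≤ n) :
    Com β (Cs β E n j) (E 0) :=
  (h.farAC (i := 0) (j := j) (by omega)).symm

theorem Sys.oA (h : Sys β E F k l n v) (hn : 2 ≤ n) :
    om β (E 0).1 (E 1).1 = v⁻¹ ∧ om β (E 0).1 (E (2 * n - 1)).1 = (v⁻¹)⁻¹ := by
  constructor
  · rw [om_comm, (h.ser 1 0 (by omega) (by omega) (by omega) (by omega) (by omega)).o,
      h.cp 1 (by omega) (by omega)]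
  · rw [om_comm, (h.ser (2 * n - 1) 0 (by omega) (by omega) (by omega) (by omega) (by omega)).o,
      h.cm _ (by omega) (by omega)]

theorem Sys.oC (h : Sys β E F k l n v) (hn : 2 ≤ n) :
    om β (E n).1 (E (n - 1)).1 = v⁻¹ ∧ om β (E n).1 (E (n + 1)).1 = (v⁻¹)⁻¹ := by
  constructor
  · rw [om_comm, (h.ser (n - 1) n (by omega) (by omega) (by omega) (by omega) (by omega)).o,
      h.cp _ (by omega) (by omega)]
  · rw [om_comm, (h.ser (n + 1) n (by omega) (by omega) (by omega) (by omega) (by omega)).o,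
      h.cm _ (by omega) (by omega)]

theorem Sys.nearA (h : Sys β E F k l n v) (hn : 2 ≤ n) {i : ℕ} (hi : 1 ≤ i) (hi2 : i < n) :
    Com β (As β E n i) (E 0) := by
  have hv := h.v0
  have o := h.oA hn
  have oef := (h.far 1 (2 * n - 1) (by omega) (by omega) (by omega)).o
  refine xs_ind (p := fun P => Com β P (E 0)) (fun _ _ a b => a.hb_left b) hi ?_ fun t _ _ =>
    ⟨(h.far _ _ (by omega) (by omega) (by omega)).symm,
      (h.far _ _ (by omega) (by omega) (by omega)).symm⟩
  refine ⟨oddSerre h.s0 h.c0 o.1 o.2 oef h.q0, ?_⟩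
  simp only [xs, hb_fst, om_addl, zero_add]
  rw [om_comm (E (2 * n - 1)).1, om_comm (E 1).1, o.1, o.2, om_self, h.c0]
  field_simp

theorem Sys.nearC (h : Sys β E F k l n v) (hn : 2 ≤ n) {i : ℕ} (hi : 1 ≤ i) (hi2 : i < n) :
    Com β (Cs β E n i) (E n) := by
  have hv := h.v0
  have o := h.oC hn
  have oef := (h.far (n - 1) (n + 1) (by omega) (by omega) (by omega)).o
  refine xs_ind (p := fun P => Com β P (E n)) (fun _ _ a b => a.hb_left b) hi ?_ fun t _ _ =>
    ⟨(h.far _ _ (by omega) (by omega) (by omega)),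
      (h.far _ _ (by omega) (by omega) (by omega)).symm⟩
  refine ⟨oddSerre h.sn h.cn o.1 o.2 oef h.qn, ?_⟩
  simp only [xs, hb_fst, om_addl, zero_add]
  rw [om_comm (E (n + 1)).1, om_comm (E (n - 1)).1, o.1, o.2, om_self, h.cn]
  field_simp

/-- `om(E_0, B_0) = 1` -/
theorem Sys.endA (h : Sys β E F k l n v) (hn : 2 ≤ n) : om β (E 0).1 (Cs β E n (n - 1)).1 = 1 := by
  obtain ⟨m, rfl⟩ : ∃ m, n = m + 2 := ⟨n - 2, by omega⟩
  have hv := h.v0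
  have o := h.oA hn
  have hc := (h.farC (j := m) (by omega)).symm.o
  have e1 : m + 2 - (m + 1) = 1 := by omega
  have e2 : m + 2 + (m + 1) = 2 * (m + 2) - 1 := by omega
  show om β (E 0).1 (hb β _ (hb β (Cs β E (m + 2) m) _)).1 = 1
  simp only [hb_fst, om_addr, e1, e2, o.1, o.2, hc]
  field_simp

theorem Sys.endC (h : Sys β E F k l n v) (hn : 2 ≤ n) : om β (E n).1 (As β E n (n - 1)).1 = 1 := by
  obtain ⟨m, rfl⟩ : ∃ m, n = m + 2 := ⟨n - 2, by omega⟩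
  have hv := h.v0
  have o := h.oC hn
  have hc := (h.farA (i := m) (j := m + 2) (by omega) (by omega)).symm.o
  have e1 : m + 2 - 1 = m + 1 := by omega
  have e2 : 2 * (m + 2) - (m + 1) = m + 2 + 1 := by omega
  show om β (E _).1 (hb β _ (hb β (As β E (m + 2) m) _)).1 = 1
  rw [e1] at o
  simp only [hb_fst, om_addr, e2, o.1, o.2, hc]
  field_simp

theorem Sys.quad (h : Sys β E F k l n v) (hn : 2 ≤ n) {i : ℕ} (hi : i + 1 < n) :
    Quad β (As β E n i) (Cs β E n (n - 2 - i)) (E (i + 1)) (E (2 * n - (i + 1))) v where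
  XY := h.farAC (by omega)
  ef := h.far _ _ (by omega) (by omega) (by omega)
  eX := (h.chA hn).serE (by omega)
  eY := by
    have := (h.chC hn).serE (k := n - 2 - i) (by omega)
    rw [show n - (n - 2 - i + 1) = i + 1 by omega] at this; exact this
  fX := (h.chA hn).serF (by omega)
  fY := by
    have := (h.chC hn).serF (k := n - 2 - i) (by omega)
    rw [show n + (n - 2 - i + 1) = 2 * n - (i + 1) by omega] at this; exact this
  cee := h.cp _ (by omega) (by omega)
  cff := h.cm _ (by omega) (by omega)
  hv := h.hv

end abs6
end QA
namespace QA
section abs7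
variable {K A Λ : Type*} [Field K] [Ring A] [Algebra K A] [AddCommGroup Λ] {β : Bic K Λ}
variable {E : ℕ → Λ × A} {F k l : ℕ → A} {n : ℕ} {v : K}

def Ts (β : Bic K Λ) (E : ℕ → Λ × A) (n : ℕ) (j : ℕ) : Λ × A :=
  hb β (As β E n j) (Cs β E n (n - 1 - j))

def Zs (β : Bic K Λ) (E : ℕ → Λ × A) (n : ℕ) (a : ℕ → K) : A :=
  ∑ j ∈ Finset.range n, a j • (Ts β E n j).2

theorem sum_zero (T : ℕ → A) (a : ℕ → K) (b : A) (s : K)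
    (h : ∀ j, j < n → T j * b = s • (b * T j)) :
    (∑ j ∈ Finset.range n, a j • T j) * b = s • (b * ∑ j ∈ Finset.range n, a j • T j) := by
  rw [Finset.sum_mul, Finset.mul_sum, Finset.smul_sum]
  refine Finset.sum_congr rfl fun j hj => ?_
  rw [smul_mul_assoc, h j (Finset.mem_range.mp hj), mul_smul_comm, smul_comm]

theorem sum_pair (T : ℕ → A) (a : ℕ → K) (b : A) (s : K) (i : ℕ) (hi : i + 1 < n)
    (h : ∀ j, j < n → j ≠ i → j ≠ i + 1 → T j * b = s • (b * T j))
    (hp : (a i • T i + a (i + 1) • T (i + 1)) * b =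
      s • (b * (a i • T i + a (i + 1) • T (i + 1)))) :
    (∑ j ∈ Finset.range n, a j • T j) * b = s • (b * ∑ j ∈ Finset.range n, a j • T j) := by
  rw [← sub_eq_zero, Finset.sum_mul, Finset.mul_sum, Finset.smul_sum, ← Finset.sum_sub_distrib,
    Finset.sum_eq_add_of_mem i (i + 1) (Finset.mem_range.mpr (by omega))
      (Finset.mem_range.mpr (by omega)) (by omega)]
  · rw [← sub_eq_zero] at hp
    rw [← hp]
    simp only [add_mul, mul_add, smul_add]
    abel
  · intro j hj hne
    rw [smul_mul_assoc, h j (Finset.mem_range.mp hj) hne.1 hne.2, mul_smul_comm, smul_comm, sub_self]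

theorem pair_W (a : ℕ → K) {i : ℕ} (hi : i + 1 < n)
    (ha : a (i + 1) = a i * rho β (As β E n i) (Cs β E n (n - 2 - i)) (E (i + 1))
      (E (2 * n - (i + 1)))) :
    a i • (Ts β E n i).2 + a (i + 1) • (Ts β E n (i + 1)).2 =
      a i • Wel β (As β E n i) (Cs β E n (n - 2 - i)) (E (i + 1)) (E (2 * n - (i + 1))) := by
  have e1 : n - 1 - i = (n - 2 - i) + 1 := by omega
  have e2 : n - 1 - (i + 1) = n - 2 - i := by omega
  have e3 : n + (n - 2 - i + 1) = 2 * n - (i + 1) := by omega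
  have e4 : n - (n - 2 - i + 1) = i + 1 := by omega
  have c : Cs β E n (n - 1 - i) = hb β (E (2 * n - (i + 1)))
      (hb β (Cs β E n (n - 2 - i)) (E (i + 1))) := by
    rw [e1]
    show hb β (E (n + (n - 2 - i + 1))) (hb β (Cs β E n (n - 2 - i)) (E (n - (n - 2 - i + 1)))) = _
    rw [e3, e4]
  have a1 : As β E n (i + 1) = hb β (E (2 * n - (i + 1))) (hb β (As β E n i) (E (i + 1))) := rfl
  unfold Ts Wel
  rw [c, e2, a1, ha, smul_add, smul_smul]

theorem Sys.zE (h : Sys β E F k l n v) (hn : 2 ≤ n) (a : ℕ → K) (δ : Λ)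
    (ha : ∀ i, i + 1 < n → a (i + 1) = a i * rho β (As β E n i) (Cs β E n (n - 2 - i)) (E (i + 1))
      (E (2 * n - (i + 1))))
    (hd : ∀ j, j < n → (Ts β E n j).1 = δ) {i : ℕ} (hi : i < 2 * n) :
    Zs β E n a * (E i).2 = β.c δ (E i).1 • ((E i).2 * Zs β E n a) := by
  have key : ∀ j, j < n → Z0 β (Ts β E n j) (E i) →
      (Ts β E n j).2 * (E i).2 = β.c δ (E i).1 • ((E i).2 * (Ts β E n j).2) := by
    intro j hj hz
    rw [← hd j hj]; exact hz
  have hW : ∀ t, t + 1 < n → (As β E n t).1 + ((E (2 * n - (t + 1))).1 +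
      ((Cs β E n (n - 2 - t)).1 + (E (t + 1)).1)) = δ := by
    intro t ht
    rw [← hd (t + 1) ht]
    show _ = ((E (2 * n - (t + 1))).1 + ((As β E n t).1 + (E (t + 1)).1)) +
      (Cs β E n (n - 1 - (t + 1))).1
    rw [show n - 1 - (t + 1) = n - 2 - t by omega]
    abel
  rcases Nat.eq_zero_or_pos i with rfl | hi0
  · refine sum_zero _ a _ _ fun j hj => key j hj ?_
    rcases Nat.eq_zero_or_pos j with rfl | hj0
    · exact end_left h.s0 h.c0 (h.endA hn)
    · exact (h.nearA hn hj0 hj).z.hb_left (h.farC (by omega)).z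
  rcases lt_trichotomy i n with hin | rfl | hin
  · obtain ⟨t, rfl⟩ : ∃ t, i = t + 1 := ⟨i - 1, by omega⟩
    refine sum_pair _ a _ _ t hin (fun j hj h1 h2 => key j hj ?_) ?_
    · have e := (show n - (n - (t + 1)) = t + 1 by omega)
      rcases lt_or_gt_of_ne h1 with h3 | h3
      · have h5 := ((h.chC hn).nearE (j := n - (t + 1)) (k := n - 1 - j) (by omega) (by omega)
          (by omega)).z
        rw [e] at h5
        exact ((h.chA hn).farE (by omega) (by omega)).z.hb_left h5
      · have h5 := ((h.chC hn).farE (j := n - (t + 1)) (k := n - 1 - j) (by omega) (by omega)).z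
        rw [e] at h5
        exact ((h.chA hn).nearE (by omega) (by omega) (by omega)).z.hb_left h5
    · rw [pair_W a hin (ha t hin), smul_mul_assoc, (h.quad hn hin).W_e, hW t hin,
        mul_smul_comm, smul_comm]
  · refine sum_zero _ a _ _ fun j hj => key j hj ?_
    rcases Nat.eq_or_lt_of_le (show j ≤ i - 1 by omega) with rfl | hj0
    · have := end_right h.sn h.cn (h.endC hn)
      unfold Ts
      rw [Nat.sub_self]
      exact this
    · exact (h.farA (by omega) (by omega)).z.hb_left (h.nearC hn (by omega) (by omega)).z
  · have hin' := hin
    clear hin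
    obtain ⟨t, rfl, hin⟩ : ∃ t, i = 2 * n - (t + 1) ∧ t + 1 < n :=
      ⟨2 * n - i - 1, by omega, by omega⟩
    clear hin'
    refine sum_pair _ a _ _ t hin (fun j hj h1 h2 => key j hj ?_) ?_
    · have e := (show n + (n - (t + 1)) = 2 * n - (t + 1) by omega)
      rcases lt_or_gt_of_ne h1 with h3 | h3
      · have h5 := ((h.chC hn).nearF (j := n - (t + 1)) (k := n - 1 - j) (by omega) (by omega)
          (by omega)).z
        rw [e] at h5
        exact ((h.chA hn).farF (j := t + 1) (by omega) (by omega)).z.hb_left h5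
      · have h5 := ((h.chC hn).farF (j := n - (t + 1)) (k := n - 1 - j) (by omega) (by omega)).z
        rw [e] at h5
        exact ((h.chA hn).nearF (j := t + 1) (by omega) (by omega) (by omega)).z.hb_left h5
    · rw [pair_W a hin (ha t hin), smul_mul_assoc, (h.quad hn hin).W_f, hW t hin,
        mul_smul_comm, smul_comm]

theorem Sys.zF (h : Sys β E F k l n v) (hn : 2 ≤ n) (a : ℕ → K)
    (ha : ∀ i, i + 1 < n → a (i + 1) = a i * rho β (As β E n i) (Cs β E n (n - 2 - i)) (E (i + 1))
      (E (2 * n - (i + 1)))) {i : ℕ} (hi : i < 2 * n) :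
    Zs β E n a * F i = F i * Zs β E n a := by
  rw [← one_smul K (F i * _)]
  have key : ∀ j, FC (F i) (Ts β E n j) →
      (Ts β E n j).2 * F i = (1 : K) • (F i * (Ts β E n j).2) := by
    intro j hz
    rw [one_smul]; exact hz
  rcases Nat.eq_zero_or_pos i with rfl | hi0
  · have hC : ∀ j, j < n → FC (F 0) (Cs β E n j) := fun j hj =>
      Cs_ind (p := fun P => FC (F 0) P) (fun _ _ a b => a.hb b)
        (h.fc _ _ (by omega) (by omega) (by omega)) fun t _ _ =>
        ⟨h.fc _ _ (by omega) (by omega) (by omega), h.fc _ _ (by omega) (by omega) (by omega)⟩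
    refine sum_zero _ a _ _ fun j hj => key j ?_
    rcases Nat.eq_zero_or_pos j with rfl | hj0
    · have := KR.base (β := β) (h.ef 0 (by omega)) (hC (n - 1) (by omega))
        ((h.klC hn hi).xs (by omega))
      refine FC.of_KR (k := k 0) (d := (E 0).1) (K := K) (s := Cs β E n (n - 1)) ?_
      convert this using 1
      swap
      · rfl
      symm
      rw [sub_eq_zero]
      exact eq_inv_of_mul_eq_one_left (h.endA hn)
    · exact FC.hb ((h.chA hn).Fx (h.ef 0 (by omega)) (h.klA hn hi)
        (fun i _ _ => h.fc _ _ (by omega) (by omega) (by omega))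
        (fun i _ _ => h.fc _ _ (by omega) (by omega) (by omega)) (by omega) (by omega))
        (hC _ (by omega))
  rcases lt_trichotomy i n with hin | rfl | hin
  · obtain ⟨t, rfl⟩ : ∃ t, i = t + 1 := ⟨i - 1, by omega⟩
    have e := (show n - (n - (t + 1)) = t + 1 by omega)
    have fA : ∀ j, j < n → j ≠ t + 1 → FC (F (t + 1)) (As β E n j) := fun j hj hne =>
      (h.chA hn).Fe (j := t + 1) (by omega) (by omega) (h.ef _ hi) (h.klA hn hi)
        (h.fc _ _ (by omega) (by omega) (by omega))
        (fun i _ _ _ => h.fc _ _ (by omega) (by omega) (by omega))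
        (fun i _ _ => h.fc _ _ (by omega) (by omega) (by omega)) (by omega) hne
    have fC : ∀ j, j < n → j ≠ n - (t + 1) → FC (F (t + 1)) (Cs β E n j) := fun j hj hne =>
      (h.chC hn).Fe (j := n - (t + 1)) (F := F (t + 1)) (k := k (t + 1)) (l := l (t + 1))
        (by omega) (by omega) (by simp only [e]; exact h.ef _ hi)
        (by simp only [e]; exact h.klC hn hi)
        (h.fc _ _ (by omega) (by omega) (by omega))
        (fun i _ _ _ => h.fc _ _ (by omega) (by omega) (by omega))
        (fun i _ _ => h.fc _ _ (by omega) (by omega) (by omega)) (by omega) hne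
    refine sum_pair _ a _ _ t hin (fun j hj h1 h2 => key j ?_) ?_
    · exact FC.hb (fA j hj h2) (fC _ (by omega) (by omega))
    · rw [pair_W a hin (ha t hin), smul_mul_assoc, (h.quad hn hin).W_Fe (h.ef _ hi)
        (fA _ (by omega) (by omega)) (fC _ (by omega) (by omega))
        (h.fc _ _ (by omega) (by omega) (by omega)) ((h.klA hn hi).xs (by omega))
        ((h.klC hn hi).xs (by omega)) (h.kl _ _ hi (by omega)), one_smul, mul_smul_comm]
  · have hA : ∀ j, j < i → FC (F i) (As β E i j) := fun j hj =>
      As_ind (p := fun P => FC (F i) P) (fun _ _ a b => a.hb b)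
        (h.fc _ _ (by omega) (by omega) (by omega)) fun t _ _ =>
        ⟨h.fc _ _ (by omega) (by omega) (by omega), h.fc _ _ (by omega) (by omega) (by omega)⟩
    refine sum_zero _ a _ _ fun j hj => key j ?_
    rcases Nat.eq_or_lt_of_le (show j ≤ i - 1 by omega) with rfl | hj0
    · have := LR.base (β := β) (h.ef i (by omega)) (hA (i - 1) (by omega))
        ((h.klA hn hi).xs (by omega))
      unfold Ts
      rw [Nat.sub_self]
      refine FC.of_LR (l := l i) (d := (E i).1) (K := K) (s := As β E i (i - 1)) ?_
      convert this using 1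
      swap
      · rfl
      symm
      rw [sub_eq_zero, om_comm]
      exact (h.endC hn).symm
    · exact FC.hb (hA _ (by omega)) ((h.chC hn).Fx (h.ef i (by omega)) (h.klC hn hi)
        (fun i _ _ => h.fc _ _ (by omega) (by omega) (by omega))
        (fun i _ _ => h.fc _ _ (by omega) (by omega) (by omega)) (by omega) (by omega))
  · have hin' := hin
    clear hin
    obtain ⟨t, rfl, hin⟩ : ∃ t, i = 2 * n - (t + 1) ∧ t + 1 < n :=
      ⟨2 * n - i - 1, by omega, by omega⟩
    clear hin'
    have e := (show n + (n - (t + 1)) = 2 * n - (t + 1) by omega)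
    have fA : ∀ j, j < n → j ≠ t + 1 → FC (F (2 * n - (t + 1))) (As β E n j) := fun j hj hne =>
      (h.chA hn).Ff (j := t + 1) (by omega) (by omega) (h.ef _ hi) (h.klA hn hi)
        (h.fc _ _ (by omega) (by omega) (by omega))
        (fun i _ _ _ => h.fc _ _ (by omega) (by omega) (by omega))
        (fun i _ _ => h.fc _ _ (by omega) (by omega) (by omega)) (by omega) hne
    have fC : ∀ j, j < n → j ≠ n - (t + 1) → FC (F (2 * n - (t + 1))) (Cs β E n j) :=
      fun j hj hne =>
      (h.chC hn).Ff (j := n - (t + 1)) (F := F (2 * n - (t + 1))) (k := k (2 * n - (t + 1)))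
        (l := l (2 * n - (t + 1))) (by omega) (by omega) (by simp only [e]; exact h.ef _ hi)
        (by simp only [e]; exact h.klC hn hi)
        (h.fc _ _ (by omega) (by omega) (by omega))
        (fun i _ _ _ => h.fc _ _ (by omega) (by omega) (by omega))
        (fun i _ _ => h.fc _ _ (by omega) (by omega) (by omega)) (by omega) hne
    refine sum_pair _ a _ _ t hin (fun j hj h1 h2 => key j ?_) ?_
    · exact FC.hb (fA j hj h2) (fC _ (by omega) (by omega))
    · rw [pair_W a hin (ha t hin), smul_mul_assoc, (h.quad hn hin).W_Ff (h.ef _ hi)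
        (fA _ (by omega) (by omega)) (fC _ (by omega) (by omega))
        (h.fc _ _ (by omega) (by omega) (by omega)) ((h.klA hn hi).xs (by omega))
        ((h.klC hn hi).xs (by omega)) (h.kl _ _ hi (by omega)), one_smul, mul_smul_comm]

end abs7
end QA
namespace QA
section con1

theorem Bfm_eq {n i j : ℕ} (hi : i < 2 * n) : Bfm n i j =
    (if (if i = 0 then 2 * n - 1 else i - 1) < n then 1 else -1) *
      ((if (if i = 0 then 2 * n - 1 else i - 1) = (if j = 0 then 2 * n - 1 else j - 1) then 1 else 0)
        - (if (if i = 0 then 2 * n - 1 else i - 1) = j then 1 else 0))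
    - (if i < n then 1 else -1) *
      ((if i = (if j = 0 then 2 * n - 1 else j - 1) then 1 else 0) - (if i = j then 1 else 0)) := by
  have hw : ∀ (i : ℕ) (t : Fin (2 * n)), wVec n i t =
      (if (t : ℕ) = (if i = 0 then 2 * n - 1 else i - 1) then 1 else 0)
        - (if (t : ℕ) = i then 1 else 0) := by
    intro i t
    unfold wVec
    by_cases h : i = 0
    · simp [h]
    · simp [h]
  unfold Bfm
  simp only [hw]
  have hp : (if i = 0 then 2 * n - 1 else i - 1) < 2 * n := by split_ifs <;> omega
  generalize (if i = 0 then 2 * n - 1 else i - 1) = p at *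
  generalize (if j = 0 then 2 * n - 1 else j - 1) = r at *
  rw [Fin.sum_univ_eq_sum_range (fun t => (if t < n then (1 : ℤ) else -1) *
    ((if t = p then 1 else 0) - (if t = i then 1 else 0)) *
    ((if t = r then 1 else 0) - (if t = j then 1 else 0)))]
  have : ∀ t, (if t < n then (1 : ℤ) else -1) *
    ((if t = p then 1 else 0) - (if t = i then 1 else 0)) *
    ((if t = r then 1 else 0) - (if t = j then 1 else 0)) =
    (if t = p then (if t < n then (1 : ℤ) else -1) *
      ((if t = r then 1 else 0) - (if t = j then 1 else 0)) else 0) -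
    (if t = i then (if t < n then (1 : ℤ) else -1) *
      ((if t = r then 1 else 0) - (if t = j then 1 else 0)) else 0) := by
    intro t
    generalize (if t < n then (1 : ℤ) else -1) = x
    generalize ((if t = r then (1 : ℤ) else 0) - (if t = j then 1 else 0)) = y
    split_ifs <;> ring
  simp only [this, Finset.sum_sub_distrib, Finset.sum_ite_eq', Finset.mem_range, hi, hp, if_true]

theorem Bfm_far {n i j : ℕ} (hj : j < 2 * n) (h : i + 2 ≤ j) (h2 : i ≠ 0 ∨ j ≠ 2 * n - 1) :
    Bfm n i j = 0 := by
  rw [Bfm_eq (by omega)]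
  grind

theorem Bfm_pp {n i : ℕ} (h1 : 1 ≤ i) (h2 : i < n) : Bfm n i i = 2 := by
  rw [Bfm_eq (by omega)]
  grind

theorem Bfm_mm {n i : ℕ} (h1 : n < i) (h2 : i < 2 * n) : Bfm n i i = -2 := by
  rw [Bfm_eq (by omega)]
  grind

theorem Bfm_00 {n : ℕ} (h : 2 ≤ n) : Bfm n 0 0 = 0 := by
  rw [Bfm_eq (by omega)]
  grind

theorem Bfm_nn {n : ℕ} (h : 2 ≤ n) : Bfm n n n = 0 := by
  rw [Bfm_eq (by omega)]
  grind

theorem Bfm_p {n i : ℕ} (hn : 2 ≤ n) (h : i < n) : Bfm n i (i + 1) = -1 ∧ Bfm n (i + 1) i = -1 := by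
  rw [Bfm_eq (by omega), Bfm_eq (by omega)]
  constructor <;> grind

theorem Bfm_m {n i : ℕ} (hn : 2 ≤ n) (h : n ≤ i) (h2 : i + 1 < 2 * n) :
    Bfm n i (i + 1) = 1 ∧ Bfm n (i + 1) i = 1 := by
  rw [Bfm_eq (by omega), Bfm_eq (by omega)]
  constructor <;> grind

theorem Bfm_c {n : ℕ} (hn : 2 ≤ n) : Bfm n 0 (2 * n - 1) = 1 ∧ Bfm n (2 * n - 1) 0 = 1 := by
  rw [Bfm_eq (by omega), Bfm_eq (by omega)]
  constructor <;> grind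

theorem sum_Icc_bot {M : Type*} [AddCommMonoid M] (g : ℕ → M) {a b : ℕ} (h : a ≤ b) :
    ∑ t ∈ Finset.Icc a b, g t = g a + ∑ t ∈ Finset.Icc (a + 1) b, g t := by
  rw [← Finset.sum_insert (s := Finset.Icc (a + 1) b) (a := a) (by simp)]
  congr 1
  ext x; simp; omega

theorem sum_Icc_top {M : Type*} [AddCommMonoid M] (g : ℕ → M) {a b c : ℕ} (hc : c = b + 1)
    (h : a ≤ c) : ∑ t ∈ Finset.Icc a c, g t = (∑ t ∈ Finset.Icc a b, g t) + g c := by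
  subst hc
  rw [Finset.sum_Icc_succ_top h]

theorem degA_succ (n i : ℕ) (hi : i + 1 < n) :
    degA n (i + 1) = αn n (2 * n - (i + 1)) + (degA n i + αn n (i + 1)) := by
  unfold degA
  rw [Finset.sum_Icc_succ_top (by omega), sum_Icc_bot (a := 2 * n - (i + 1)) _ (by omega),
    show 2 * n - (i + 1) + 1 = 2 * n - i by omega]
  abel

theorem degB_pred (n i : ℕ) (hi : i + 1 < n) :
    degB n i = αn n (2 * n - (i + 1)) + (degB n (i + 1) + αn n (i + 1)) := by
  unfold degB
  rw [sum_Icc_bot _ (by omega), sum_Icc_top (b := 2 * n - (i + 1) - 1) _ (by omega) (by omega),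
    show 2 * n - i - 1 = 2 * n - (i + 1) by omega]
  abel

theorem deg_sum (n i : ℕ) (hi : i < n) : degA n i + degB n i = hatδ n := by
  induction i with
  | zero =>
    unfold degA degB hatδ
    rw [Finset.range_eq_Ico, show Finset.Ico 0 (2 * n) = Finset.Icc 0 (2 * n - 1) by
      ext x; simp; omega, sum_Icc_bot _ (Nat.zero_le _)]
    have h1 : Finset.Icc 1 0 = (∅ : Finset ℕ) := by simp
    have h2 : Finset.Icc (2 * n - 0) (2 * n - 1) = (∅ : Finset ℕ) := by
      ext x; simp; omega
    rw [h1, h2]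
    simp
  | succ i ih =>
    rw [← ih (by omega), degA_succ n i hi, degB_pred n i hi]
    abel

end con1
end QA
namespace QA
section con2
variable {K : Type} [Field K] {n : ℕ} {χ : Lam n → Lam n → Kˣ}

def mkB (χ : Lam n → Lam n → Kˣ) (h1 : ∀ a b c : Lam n, χ (a + b) c = χ a c * χ b c)
    (h2 : ∀ a b c : Lam n, χ a (b + c) = χ a b * χ a c) : Bic K (Lam n) where
  c l m := (((χ m l)⁻¹ : Kˣ) : K)
  ne _ _ := Units.ne_zero _
  addl a b d := by rw [h2, mul_inv, Units.val_mul]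
  addr a b d := by rw [h1, mul_inv, Units.val_mul]

def cE (χ : Lam n → Lam n → Kˣ) (t : ℕ) : Lam n × Unat K n χ := (αn n t, uEn K n χ t)
def cF (χ : Lam n → Lam n → Kˣ) (t : ℕ) : Unat K n χ :=
  if h : t < 2 * n then uF K n χ ⟨t, h⟩ else 0
def cK (χ : Lam n → Lam n → Kˣ) (t : ℕ) : Unat K n χ := uK K n χ (αn n t)
def cL (χ : Lam n → Lam n → Kˣ) (t : ℕ) : Unat K n χ := uL K n χ (αn n t)

theorem cE_eq {t : ℕ} (h : t < 2 * n) : cE χ t = (αr n ⟨t, h⟩, uE K n χ ⟨t, h⟩) := by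
  simp [cE, αn, uEn, h]
theorem cF_eq {t : ℕ} (h : t < 2 * n) : cF χ t = uF K n χ ⟨t, h⟩ := by
  simp [cF, h]
theorem αn_eq {t : ℕ} (h : t < 2 * n) : αn n t = αr n ⟨t, h⟩ := by
  simp [αn, h]

theorem rel {x y : FA K n} (h : NRel K n χ x y) :
    RingQuot.mkAlgHom K (NRel K n χ) x = RingQuot.mkAlgHom K (NRel K n χ) y :=
  RingQuot.mkAlgHom_rel K h

theorem mk_fbrE (a b : Lam n) (x y : FA K n) :
    RingQuot.mkAlgHom K (NRel K n χ) (fbrE K n χ a b x y) =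
      ubrE K n χ a b (RingQuot.mkAlgHom K (NRel K n χ) x) (RingQuot.mkAlgHom K (NRel K n χ) y) := by
  unfold fbrE ubrE
  rw [map_sub, map_mul, map_smul, map_mul]

variable (h1 : ∀ a b c : Lam n, χ (a + b) c = χ a c * χ b c)
    (h2 : ∀ a b c : Lam n, χ a (b + c) = χ a b * χ a c)

theorem z1 (i j : Fin (2 * n)) (h : Bfm n i j = 0) :
    Z0 (mkB χ h1 h2) (αr n i, uE K n χ i) (αr n j, uE K n χ j) := by
  have := rel (NRel.SE1 (χ := χ) i j h)
  rw [mk_fbrE, map_zero] at this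
  rw [Z0_iff]
  exact this

theorem z2 (i j : Fin (2 * n)) (h : i ≠ j) (h3 : -(2 * Bfm n i j) = Bfm n i i)
    (h4 : Bfm n i i ≠ 0) :
    Z0 (mkB χ h1 h2) (αr n i, uE K n χ i)
      (hb (mkB χ h1 h2) (αr n i, uE K n χ i) (αr n j, uE K n χ j)) := by
  have := rel (NRel.SE2 (χ := χ) i j h h3 h4)
  rw [mk_fbrE, mk_fbrE, map_zero] at this
  rw [Z0_iff]
  exact this

theorem z4 (i j k : Fin (2 * n)) (g1 : i ≠ j) (g2 : j ≠ k) (g3 : k ≠ i)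
      (h4 : Bfm n i i = 0) (h5 : Bfm n j k = 0)
      (h6 : -(Bfm n i j) = Bfm n i k) (h7 : Bfm n i k ≠ 0) :
    Z0 (mkB χ h1 h2) (hb (mkB χ h1 h2) (αr n i, uE K n χ i) (αr n j, uE K n χ j))
      (hb (mkB χ h1 h2) (αr n i, uE K n χ i) (αr n k, uE K n χ k)) := by
  have := rel (NRel.SE4 (χ := χ) i j k g1 g2 g3 h4 h5 h6 h7)
  rw [mk_fbrE, mk_fbrE, mk_fbrE, map_zero] at this
  rw [Z0_iff]
  exact this

theorem sq_aux {A : Type*} [Ring A] [Algebra K A] [CharZero K] {x : A}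
    (h : x = (-1 : K)⁻¹ • x) : x = 0 := by
  have h3 : (2 : K) • x = 0 := by
    rw [two_smul]
    nth_rewrite 1 [h]
    rw [show (-1 : K)⁻¹ = -1 by norm_num, neg_one_smul]
    simp
  exact (smul_eq_zero_iff_right (two_ne_zero)).1 h3

theorem sq [CharZero K] (h1 : ∀ a b c : Lam n, χ (a + b) c = χ a c * χ b c)
    (h2 : ∀ a b c : Lam n, χ a (b + c) = χ a b * χ a c) (i : Fin (2 * n)) (h : Bfm n i i = 0)
    (h0 : ((χ (αr n i) (αr n i) : Kˣ) : K) = -1) : uE K n χ i * uE K n χ i = 0 := by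
  have := z1 h1 h2 i i h
  simp only [Z0, mkB, Units.val_inv_eq_inv_val, h0] at this
  exact sq_aux this

theorem omc (q : Kˣ) (hχij : ∀ i j : Fin (2 * n), i ≠ j →
      χ (αr n i) (αr n j) * χ (αr n j) (αr n i) = q ^ (2 * Bfm n i j)) (i j : Fin (2 * n))
    (h : i ≠ j) : om (mkB χ h1 h2) (αr n i) (αr n j) = (((q ^ (2 * Bfm n i j))⁻¹ : Kˣ) : K) := by
  rw [← hχij i j h]
  simp [om, mkB, mul_comm]

theorem serc (q : Kˣ) 
    (hχd : ∀ i : Fin (2 * n), Bfm n i i ≠ 0 →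
      χ (αr n i) (αr n i) = q ^ (Bfm n i i)) (hχij : ∀ i j : Fin (2 * n), i ≠ j →
      χ (αr n i) (αr n j) * χ (αr n j) (αr n i) = q ^ (2 * Bfm n i j)) (i j : Fin (2 * n))
    (h : i ≠ j) (h3 : -(2 * Bfm n i j) = Bfm n i i)
    (h4 : Bfm n i i ≠ 0) :
    Ser (mkB χ h1 h2) (αr n i, uE K n χ i) (αr n j, uE K n χ j) := by
  refine ⟨?_, z2 h1 h2 i j h h3 h4⟩
  simp only [omc h1 h2 q hχij i j h]
  simp only [mkB, hχd i h4, ← h3]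
  simp [zpow_neg]

theorem sysc [CharZero K] (hn : 2 ≤ n)
    (q : Kˣ) (hq : ∀ m : ℕ, 0 < m → (q : K) ^ m ≠ 1)
    (hχd : ∀ i : Fin (2 * n), Bfm n i i ≠ 0 →
      χ (αr n i) (αr n i) = q ^ (Bfm n i i))
    (hχ0 : ∀ i : Fin (2 * n), Bfm n i i = 0 →
      ((χ (αr n i) (αr n i) : Kˣ) : K) = -1)
    (hχij : ∀ i j : Fin (2 * n), i ≠ j →
      χ (αr n i) (αr n j) * χ (αr n j) (αr n i) = q ^ (2 * Bfm n i j)) :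
    Sys (mkB χ h1 h2) (cE χ) (cF χ) (cK χ) (cL χ) n ((((q : K)) ^ 2)⁻¹) where
  far i j hij hj ho := by
    rw [cE_eq hj, cE_eq (show i < 2 * n by omega)]
    refine ⟨z1 h1 h2 _ _ (Bfm_far hj hij ho), ?_⟩
    have hne : (⟨i, by omega⟩ : Fin (2 * n)) ≠ ⟨j, hj⟩ := by
      intro h; have := congrArg Fin.val h; simp at this; omega
    simp only [omc h1 h2 q hχij _ _ hne, Bfm_far hj hij ho]
    simp
  ser i j hi hj i0 i1 h := by
    rw [cE_eq hj, cE_eq hi]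
    have hne : (⟨i, hi⟩ : Fin (2 * n)) ≠ ⟨j, hj⟩ := by
      intro h; have := congrArg Fin.val h; simp at this; omega
    have key : -(2 * Bfm n i j) = Bfm n i i ∧ Bfm n i i ≠ 0 := by
      by_cases hin : i < n
      · rw [Bfm_pp (by omega) hin]
        refine ⟨?_, by norm_num⟩
        rcases h with rfl | rfl | ⟨rfl, rfl⟩
        · rw [(Bfm_p hn hin).1]; norm_num
        · rw [(Bfm_p hn (by omega)).2]; norm_num
        · omega
      · rw [Bfm_mm (by omega) hi]
        refine ⟨?_, by norm_num⟩
        rcases h with rfl | rfl | ⟨rfl, rfl⟩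
        · rw [(Bfm_m hn (by omega) (by omega)).1]; norm_num
        · rw [(Bfm_m hn (by omega) (by omega)).2]; norm_num
        · rw [(Bfm_c hn).2]; norm_num
    exact serc h1 h2 q hχd hχij _ _ hne key.1 key.2
  cp i hi1 hi := by
    rw [cE_eq (show i < 2 * n by omega)]
    have hb := Bfm_pp hi1 hi
    simp only [mkB, hχd ⟨i, by omega⟩ (by simp [hb]), hb]
    simp
    try rfl
  cm i hi1 hi := by
    rw [cE_eq hi]
    have hb := Bfm_mm hi1 hi
    simp only [mkB, hχd ⟨i, by omega⟩ (by simp [hb]), hb]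
    simp [zpow_neg]
    try rfl
  c0 := by
    rw [cE_eq (show 0 < 2 * n by omega)]
    simp only [mkB, Units.val_inv_eq_inv_val, hχ0 ⟨0, by omega⟩ (Bfm_00 hn)]
    norm_num
  cn := by
    rw [cE_eq (show n < 2 * n by omega)]
    simp only [mkB, Units.val_inv_eq_inv_val, hχ0 ⟨n, by omega⟩ (Bfm_nn hn)]
    norm_num
  s0 := by
    rw [cE_eq (show 0 < 2 * n by omega)]
    exact sq h1 h2 _ (Bfm_00 hn) (hχ0 ⟨0, by omega⟩ (Bfm_00 hn))
  sn := by
    rw [cE_eq (show n < 2 * n by omega)]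
    exact sq h1 h2 _ (Bfm_nn hn) (hχ0 ⟨n, by omega⟩ (Bfm_nn hn))
  q0 := by
    rw [cE_eq (show 0 < 2 * n by omega), cE_eq (show 1 < 2 * n by omega),
      cE_eq (show 2 * n - 1 < 2 * n by omega)]
    refine z4 h1 h2 _ _ _ ?_ ?_ ?_ (Bfm_00 hn) (Bfm_far (by simp; omega) (by simp; omega)
      (by simp)) ?_ ?_
    · simp [Fin.ext_iff]
    · simp [Fin.ext_iff]; omega
    · simp [Fin.ext_iff]; omega
    · have a := (Bfm_p (i := 0) hn (by omega)).1
      have b := (Bfm_c hn).1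
      simp only [zero_add] at a
      simp only [a, b]; norm_num
    · have b := (Bfm_c hn).1
      simp only [b]; norm_num
  qn := by
    rw [cE_eq (show n < 2 * n by omega), cE_eq (show n - 1 < 2 * n by omega),
      cE_eq (show n + 1 < 2 * n by omega)]
    refine z4 h1 h2 _ _ _ ?_ ?_ ?_ (Bfm_nn hn) (Bfm_far (by simp; omega) (by simp; omega)
      (by simp; omega)) ?_ ?_
    · simp [Fin.ext_iff]; omega
    · simp [Fin.ext_iff]; try omega
    · simp [Fin.ext_iff]
    · have a := (Bfm_p (i := n - 1) hn (by omega)).2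
      have b := (Bfm_m (i := n) hn (by omega) (by omega)).1
      rw [show n - 1 + 1 = n by omega] at a
      simp only [a, b]; norm_num
    · have b := (Bfm_m (i := n) hn (by omega) (by omega)).1
      simp only [b]; norm_num
  v0 := by simp
  hv := by
    intro h
    have hq0 : (q : K) ≠ 0 := q.ne_zero
    apply hq 4 (by norm_num)
    field_simp at h
    linear_combination ((q : K) ^ 2 - 1) * h
  ef i hi := by
    rw [cE_eq hi, cF_eq hi, cK, cL, αn_eq hi]
    have := rel (NRel.EFsame (χ := χ) ⟨i, hi⟩)
    simp only [map_sub, map_mul, map_add, map_neg] at this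
    exact this
  fc i j hi hj hij := by
    rw [cE_eq hj, cF_eq hi]
    have := rel (NRel.EFne (χ := χ) ⟨j, hj⟩ ⟨i, hi⟩ (by simp [Fin.ext_iff]; omega))
    simp only [map_sub, map_mul, map_zero] at this
    exact sub_eq_zero.1 this
  kl i j hi hj := by
    rw [cE_eq hj, cE_eq hi, cK, cL, αn_eq hi]
    refine ⟨?_, ?_⟩
    · have := rel (NRel.KE (χ := χ) (αr n ⟨i, hi⟩) ⟨j, hj⟩)
      simp only [map_mul, map_smul] at this
      simp only [mkB, Units.val_inv_eq_inv_val, inv_inv]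
      exact this
    · have := rel (NRel.LE (χ := χ) (αr n ⟨i, hi⟩) ⟨j, hj⟩)
      simp only [map_mul, map_smul] at this
      exact this

theorem As_eq {i : ℕ} (hi : i < n) :
    As (mkB χ h1 h2) (cE χ) n i = (degA n i, Aseq K n χ i) := by
  induction i with
  | zero =>
    have : degA n 0 = αn n 0 := by
      have h2 : Finset.Icc (2 * n - 0) (2 * n - 1) = (∅ : Finset ℕ) := by
        ext x; simp; omega
      unfold degA
      rw [h2]; simp
    rw [this]; rfl
  | succ i ih =>
    have e : As (mkB χ h1 h2) (cE χ) n (i + 1) = hb (mkB χ h1 h2) (cE χ (2 * n - (i + 1)))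
      (hb (mkB χ h1 h2) (As (mkB χ h1 h2) (cE χ) n i) (cE χ (i + 1))) := rfl
    rw [e, ih (by omega), degA_succ n i hi]
    rfl

theorem Cs_eq {i : ℕ} (hi : i < n) :
    Cs (mkB χ h1 h2) (cE χ) n i = (degB n (n - 1 - i), Cseq K n χ i) := by
  induction i with
  | zero =>
    have : degB n (n - 1 - 0) = αn n n := by
      unfold degB
      rw [show n - 1 - 0 + 1 = n by omega, show 2 * n - (n - 1 - 0) - 1 = n by omega]
      simp
    rw [this]; rfl
  | succ i ih =>
    have e : Cs (mkB χ h1 h2) (cE χ) n (i + 1) = hb (mkB χ h1 h2) (cE χ (n + (i + 1)))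
      (hb (mkB χ h1 h2) (Cs (mkB χ h1 h2) (cE χ) n i) (cE χ (n - (i + 1)))) := rfl
    rw [e, ih (by omega), degB_pred n (n - 1 - (i + 1)) (by omega),
      show n - 1 - (i + 1) + 1 = n - 1 - i by omega, show n - (i + 1) = n - 1 - i by omega,
      show 2 * n - (n - 1 - i) = n + (i + 1) by omega]
    rfl

theorem Zs_eq : Zs (mkB χ h1 h2) (cE χ) n (aScal K n χ) = Zel K n χ := by
  unfold Zs Zel
  refine Finset.sum_congr rfl fun j hj => ?_
  rw [Finset.mem_range] at hj
  unfold Ts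
  rw [As_eq h1 h2 hj, Cs_eq h1 h2 (by omega), show n - 1 - (n - 1 - j) = j by omega]
  rfl

theorem Ts_deg {j : ℕ} (hj : j < n) : (Ts (mkB χ h1 h2) (cE χ) n j).1 = hatδ n := by
  unfold Ts
  rw [As_eq h1 h2 hj, Cs_eq h1 h2 (by omega), show n - 1 - (n - 1 - j) = j by omega]
  exact deg_sum n j hj

theorem neg_l (h1 : ∀ a b c : Lam n, χ (a + b) c = χ a c * χ b c)
    (a b : Lam n) : χ (-a) b = (χ a b)⁻¹ := by
  have h0 : χ 0 b = 1 := by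
    have := h1 0 0 b
    rw [add_zero] at this
    exact (mul_eq_left.1 this.symm)
  rw [eq_inv_iff_mul_eq_one, ← h1, neg_add_cancel, h0]

theorem neg_r (h2 : ∀ a b c : Lam n, χ a (b + c) = χ a b * χ a c)
    (a b : Lam n) : χ a (-b) = (χ a b)⁻¹ := by
  have h0 : χ a 0 = 1 := by
    have := h2 a 0 0
    rw [add_zero] at this
    exact (mul_eq_left.1 this.symm)
  rw [eq_inv_iff_mul_eq_one, ← h2, neg_add_cancel, h0]

theorem rho_eq {i : ℕ} (hi : i + 1 < n) : aScal K n χ (i + 1) = aScal K n χ i *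
    rho (mkB χ h1 h2) (As (mkB χ h1 h2) (cE χ) n i) (Cs (mkB χ h1 h2) (cE χ) n (n - 2 - i))
      (cE χ (i + 1)) (cE χ (2 * n - (i + 1))) := by
  rw [As_eq h1 h2 (by omega), Cs_eq h1 h2 (by omega), show n - 1 - (n - 2 - i) = i + 1 by omega]
  have d1 : ∑ t ∈ Finset.Icc (i + 2) (2 * n - i - 2), αn n t = degB n (i + 1) := by
    unfold degB
    rw [show 2 * n - (i + 1) - 1 = 2 * n - i - 2 by omega]
  rw [aScal, sum_Icc_bot (a := i + 1) _ (by omega), d1, ← deg_sum n i (by omega),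
    degB_pred n i hi, show 2 * n - i - 1 = 2 * n - (i + 1) by omega]
  simp only [rho, cE, mkB, h1, h2, neg_l h1, neg_r h2, Units.val_mul, Units.val_inv_eq_inv_val,
    mul_inv, inv_inv]
  have hu : ∀ a b, ((χ a b : Kˣ) : K) ≠ 0 := fun a b => (χ a b).ne_zero
  have k1 := hu (αn n (i + 1)) (αn n (2 * n - (i + 1)))
  have k2 := hu (degB n (i + 1)) (αn n (2 * n - (i + 1)))
  have k3 := hu (αn n (i + 1)) (degB n (i + 1))
  field_simp

end con2
end QA
/-- the element `Z = Σ a_i ⌊A_i,B_i⌋ ∈ U^♮_χ` (case of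
`sl^{(1)}(n|n)`) commutes with all `F_i` and `q`-commutes with all `E_i`. -/
theorem stmt12 (K : Type) [Field K] [CharZero K] (n : ℕ) (hn : 2 ≤ n)
    (q : Kˣ) (hq : ∀ m : ℕ, 0 < m → (q : K) ^ m ≠ 1)
    (χ : Lam n → Lam n → Kˣ)
    (hχ1 : ∀ a b c : Lam n, χ (a + b) c = χ a c * χ b c)
    (hχ2 : ∀ a b c : Lam n, χ a (b + c) = χ a b * χ a c)
    (hχd : ∀ i : Fin (2 * n), Bfm n i i ≠ 0 →
      χ (αr n i) (αr n i) = q ^ (Bfm n i i))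
    (hχ0 : ∀ i : Fin (2 * n), Bfm n i i = 0 →
      ((χ (αr n i) (αr n i) : Kˣ) : K) = -1)
    (hχij : ∀ i j : Fin (2 * n), i ≠ j →
      χ (αr n i) (αr n j) * χ (αr n j) (αr n i) = q ^ (2 * Bfm n i j))
    (hχdd : χ (dr n) (dr n) = 1)
    (hχdi : ∀ i : Fin (2 * n),
      χ (dr n) (αr n i) = q ^ (if (i : ℕ) = 0 then (1 : ℕ) else 0) ∧
      χ (αr n i) (dr n) = q ^ (if (i : ℕ) = 0 then (1 : ℕ) else 0)) :
    ∀ i : Fin (2 * n),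
      Zel K n χ * uF K n χ i - uF K n χ i * Zel K n χ = 0 ∧
      Zel K n χ * uE K n χ i
        - ((((χ (αr n i) (hatδ n))⁻¹ : Kˣ) : K)) • (uE K n χ i * Zel K n χ) = 0 := by
  intro i
  have hs := QA.sysc hχ1 hχ2 hn q hq hχd hχ0 hχij
  have hF := hs.zF hn (aScal K n χ) (fun j hj => QA.rho_eq hχ1 hχ2 hj) i.2
  have hE := hs.zE hn (aScal K n χ) (hatδ n) (fun j hj => QA.rho_eq hχ1 hχ2 hj)
    (fun j hj => QA.Ts_deg hχ1 hχ2 hj) i.2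
  rw [QA.Zs_eq, QA.cF_eq i.2] at hF
  rw [QA.Zs_eq, QA.cE_eq i.2] at hE
  exact ⟨sub_eq_zero.2 hF, sub_eq_zero.2 hE⟩
end
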